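/- For a fixed point z ∈ ℝ³ with ‖z‖ < R and any x on the sphere of radius R, the gradient of the Laplace fundamental solution admits the expansion ∇Γ₀(x−z) = Σ_{n=0}^∞ Σ_{m=−n}^{n} [((n+1) Yₙᵐ(x̂) x̂ − ∇_S Yₙᵐ(x̂)) / ((2n+1) R^{n+2})] · conj(Yₙᵐ(ẑ)) ‖z‖ⁿ, where x̂ = x/‖x‖, ẑ = z/‖z‖. -/

import Mathlib

open Real MeasureTheory

local notation "E3" => EuclideanSpace ℝ (Fin 3)

/-- The fundamental solution of the Laplacian in ℝ³. -/
noncomputable def Gamma0 (x : E3) : ℝ := -1 / (4 * Real.pi * ‖x‖)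

/-- Partial derivative of a ℂ-valued function in the `i`-th direction. -/
noncomputable def pdC (f : E3 → ℂ) (i : Fin 3) (x : E3) : ℂ :=
  fderiv ℝ f x (EuclideanSpace.single i 1)

/-- The (componentwise) Laplacian of a ℂ-valued function. -/
noncomputable def lapC (f : E3 → ℂ) (x : E3) : ℂ := ∑ i : Fin 3, pdC (pdC f i) i x

/-- Radial projection `x ↦ x/‖x‖`. -/
noncomputable def unitize (x : E3) : E3 := ‖x‖⁻¹ • x

/-- Surface gradient on `𝕊²`: gradient of the degree-0 homogeneous extension. -/
noncomputable def surfGrad (f : E3 → ℂ) (x : E3) (i : Fin 3) : ℂ :=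
  fderiv ℝ (fun y => f (unitize y)) x (EuclideanSpace.single i 1)

/-- Surface measure on the unit sphere. -/
noncomputable def sphereMeasure : Measure (Metric.sphere (0 : E3) 1) :=
  (volume : Measure E3).toSphere

open Set in
lemma integral_polar (a : ℝ → ℂ) (f : E3 → ℂ) :
    ∫ y : E3, a ‖y‖ * f (unitize y) =
      (∫ r in Ioi (0 : ℝ), (r : ℂ) ^ 2 * a r) *
        ∫ v : Metric.sphere (0 : E3) 1, f v ∂sphereMeasure := by
  have hdim : Module.finrank ℝ E3 - 1 = 2 := by simp
  calc
    ∫ y : E3, a ‖y‖ * f (unitize y)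
      = ∫ y : ({(0)}ᶜ : Set E3), a ‖y.1‖ * f (unitize y.1) ∂((volume : Measure E3).comap (↑)) := by
      rw [integral_subtype_comap (measurableSet_singleton _).compl
        fun y : E3 ↦ a ‖y‖ * f (unitize y), restrict_compl_singleton]
    _ = ∫ p, f p.1.1 * a p.2.1
          ∂sphereMeasure.prod (.volumeIoiPow (Module.finrank ℝ E3 - 1)) := by
      rw [sphereMeasure, ← (volume : Measure E3).measurePreserving_homeomorphUnitSphereProd.integral_comp
        (Homeomorph.measurableEmbedding _)
        (fun p : Metric.sphere (0 : E3) 1 × Ioi (0 : ℝ) => f p.1.1 * a p.2.1)]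
      simp [unitize, mul_comm]
    _ = (∫ v : Metric.sphere (0 : E3) 1, f v ∂sphereMeasure) *
          ∫ r : Ioi (0 : ℝ), a r ∂.volumeIoiPow (Module.finrank ℝ E3 - 1) := by
      have : SFinite sphereMeasure := by unfold sphereMeasure; infer_instance
      exact integral_prod_mul (fun v : Metric.sphere (0 : E3) 1 => f v)
        (fun r : Ioi (0 : ℝ) => a r)
    _ = _ := by
      rw [hdim, mul_comm]
      congr 1
      simp only [Measure.volumeIoiPow, ENNReal.ofReal]
      rw [integral_withDensity_eq_integral_smul,
        integral_subtype_comap measurableSet_Ioi fun r ↦ Real.toNNReal (r ^ 2) • a r,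
        setIntegral_congr_fun measurableSet_Ioi fun x hx ↦ ?_]
      · simp only [NNReal.smul_def, Real.coe_toNNReal _ (pow_nonneg hx.out.le 2)]
        simp
      · exact (measurable_subtype_coe.pow_const _).real_toNNReal

lemma sphereMeasure_real_univ : sphereMeasure.real Set.univ = 4 * π := by
  rw [sphereMeasure, Measure.toSphere_real_apply_univ, Measure.real,
    EuclideanSpace.volume_ball_fin_three]
  rw [ENNReal.toReal_mul, ENNReal.toReal_ofReal (by positivity)]
  simp
  ring

instance : IsFiniteMeasure sphereMeasure := by unfold sphereMeasure; infer_instance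

instance : sphereMeasure.IsOpenPosMeasure := by unfold sphereMeasure; infer_instance

/-- Positive homogeneity of degree `d` away from the origin. -/
def IsHomog (d : ℤ) (h : E3 → ℂ) : Prop :=
  ∀ c : ℝ, 0 < c → ∀ y : E3, y ≠ 0 → h (c • y) = (c : ℂ) ^ d * h y

/-- Smoothness away from the origin. -/
def SmoothOff (h : E3 → ℂ) : Prop := ContDiffOn ℝ (⊤ : ℕ∞) h {x : E3 | x ≠ 0}

lemma isOpen_ne_zero : IsOpen {x : E3 | x ≠ 0} := isOpen_ne

lemma SmoothOff.contDiffAt {h : E3 → ℂ} (hh : SmoothOff h) {y : E3} (hy : y ≠ 0) :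
    ContDiffAt ℝ (⊤ : ℕ∞) h y := ContDiffOn.contDiffAt hh (isOpen_ne_zero.mem_nhds hy)

lemma SmoothOff.differentiableAt {h : E3 → ℂ} (hh : SmoothOff h) {y : E3} (hy : y ≠ 0) :
    DifferentiableAt ℝ h y := (hh.contDiffAt hy).differentiableAt (by simp)

lemma SmoothOff.mul {f g : E3 → ℂ} (hf : SmoothOff f) (hg : SmoothOff g) :
    SmoothOff (fun y => f y * g y) := ContDiffOn.mul hf hg

lemma SmoothOff.add {f g : E3 → ℂ} (hf : SmoothOff f) (hg : SmoothOff g) :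
    SmoothOff (fun y => f y + g y) := ContDiffOn.add hf hg

lemma SmoothOff.sub {f g : E3 → ℂ} (hf : SmoothOff f) (hg : SmoothOff g) :
    SmoothOff (fun y => f y - g y) := ContDiffOn.sub hf hg

lemma SmoothOff.sum {ι : Type*} {s : Finset ι} {f : ι → E3 → ℂ}
    (hf : ∀ j ∈ s, SmoothOff (f j)) : SmoothOff (fun y => ∑ j ∈ s, f j y) :=
  ContDiffOn.sum hf

lemma SmoothOff.const (c : ℂ) : SmoothOff (fun _ => c) := contDiffOn_const

lemma SmoothOff.conj {f : E3 → ℂ} (hf : SmoothOff f) :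
    SmoothOff (fun y => (starRingEnd ℂ) (f y)) :=
  (Complex.conjCLE : ℂ ≃L[ℝ] ℂ).contDiff.comp_contDiffOn hf

lemma SmoothOff.pdC {f : E3 → ℂ} (hf : SmoothOff f) (i : Fin 3) : SmoothOff (pdC f i) := by
  have h1 : ContDiffOn ℝ (⊤ : ℕ∞) (fderiv ℝ f) {x : E3 | x ≠ 0} :=
    ContDiffOn.fderiv_of_isOpen hf isOpen_ne_zero (by simp)
  exact h1.clm_apply contDiffOn_const

lemma SmoothOff.coord (i : Fin 3) : SmoothOff (fun y : E3 => ((y i : ℝ) : ℂ)) := by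
  have : ContDiff ℝ (⊤ : ℕ∞) (fun y : E3 => ((y i : ℝ) : ℂ)) :=
    Complex.ofRealCLM.contDiff.comp (EuclideanSpace.proj (𝕜 := ℝ) i).contDiff
  exact this.contDiffOn

lemma SmoothOff.continuous_sphere {f : E3 → ℂ} (hf : SmoothOff f) :
    Continuous (fun v : Metric.sphere (0 : E3) 1 => f v) := by
  refine ContinuousOn.comp_continuous (ContDiffOn.continuousOn hf) continuous_subtype_val ?_
  intro v
  exact Metric.ne_of_mem_sphere v.2 one_ne_zero

lemma SmoothOff.integrable {f : E3 → ℂ} (hf : SmoothOff f) :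
    Integrable (fun v : Metric.sphere (0 : E3) 1 => f v) sphereMeasure :=
  hf.continuous_sphere.integrable_of_hasCompactSupport (HasCompactSupport.of_compactSpace _)

lemma unitize_ne_zero {y : E3} (hy : y ≠ 0) : unitize y ≠ 0 := by
  simp [unitize, hy]

lemma norm_unitize {y : E3} (hy : y ≠ 0) : ‖unitize y‖ = 1 := by
  simp [unitize, norm_smul, hy]

lemma unitize_of_norm_eq_one {y : E3} (hy : ‖y‖ = 1) : unitize y = y := by
  simp [unitize, hy]

lemma IsHomog.eq_unitize {d : ℤ} {h : E3 → ℂ} (hh : IsHomog d h) {y : E3} (hy : y ≠ 0) :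
    h y = (‖y‖ : ℂ) ^ d * h (unitize y) := by
  rw [← hh ‖y‖ (norm_pos_iff.mpr hy) _ (unitize_ne_zero hy), unitize, smul_smul,
    mul_inv_cancel₀ (norm_ne_zero_iff.mpr hy), one_smul]

lemma IsHomog.pdC {d : ℤ} {h : E3 → ℂ} (hh : IsHomog d h) (hs : SmoothOff h) (i : Fin 3) :
    IsHomog (d - 1) (pdC h i) := by
  intro c hc y hy
  have hcy : c • y ≠ 0 := smul_ne_zero hc.ne' hy
  have h1 : HasFDerivAt (fun w : E3 => h (c • w))
      ((fderiv ℝ h (c • y)).comp (c • ContinuousLinearMap.id ℝ E3)) y :=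
    (hs.differentiableAt hcy).hasFDerivAt.comp y ((hasFDerivAt_id y).const_smul c)
  have h2 : HasFDerivAt (fun w : E3 => h (c • w)) (((c : ℂ) ^ d) • fderiv ℝ h y) y := by
    refine ((hs.differentiableAt hy).hasFDerivAt.const_smul ((c : ℂ) ^ d)).congr_of_eventuallyEq ?_
    filter_upwards [isOpen_ne_zero.mem_nhds hy] with w hw
    exact hh c hc w hw
  have h3 := congrArg (fun L => L (EuclideanSpace.single i (1 : ℝ))) (h1.unique h2)
  simp at h3
  have hc' : (c : ℂ) ≠ 0 := by exact_mod_cast hc.ne'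
  rw [_root_.pdC, _root_.pdC, zpow_sub_one₀ hc', mul_right_comm, ← h3]
  field_simp

lemma fderiv_eq_sum_pdC (h : E3 → ℂ) (y v : E3) :
    fderiv ℝ h y v = ∑ i, (v i : ℂ) * pdC h i y := by
  conv_lhs => rw [← (EuclideanSpace.basisFun (Fin 3) ℝ).sum_repr v]
  simp [pdC]

lemma IsHomog.euler {d : ℤ} {h : E3 → ℂ} (hh : IsHomog d h) (hs : SmoothOff h)
    {y : E3} (hy : y ≠ 0) : ∑ i, (y i : ℂ) * _root_.pdC h i y = d * h y := by
  rw [← fderiv_eq_sum_pdC]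
  have h1 : HasDerivAt (fun c : ℝ => h (c • y)) (fderiv ℝ h y y) 1 := by
    have h0 : HasFDerivAt h (fderiv ℝ h y) ((1 : ℝ) • y) := by
      rw [one_smul]; exact (hs.differentiableAt hy).hasFDerivAt
    have := h0.comp_hasDerivAt (1 : ℝ) ((hasDerivAt_id (1 : ℝ)).smul_const y)
    simpa [Function.comp_def] using! this
  have h2 : HasDerivAt (fun c : ℝ => h (c • y)) (d * h y) 1 := by
    have h0 : HasDerivAt (fun c : ℝ => (c : ℂ) ^ d * h y) (d * h y) 1 := by
      have := (hasDerivAt_zpow d (((1 : ℝ) : ℂ)) (by simp)).comp_ofReal.mul_const (h y)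
      simpa using this
    refine h0.congr_of_eventuallyEq ?_
    filter_upwards [lt_mem_nhds (zero_lt_one (α := ℝ))] with c hc
    exact hh c hc y hy
  exact h1.unique h2
/-- A smooth bump function on the half-line, supported in `[1, 3]`. -/
noncomputable def radialBump : ContDiffBump (2 : ℝ) := ⟨1 / 2, 1, by norm_num, by norm_num⟩

lemma radialBump_eq_zero {r : ℝ} (hr : r ≤ 1 ∨ 3 ≤ r) : radialBump r = 0 := by
  apply radialBump.zero_of_le_dist
  rw [Real.dist_eq]
  rcases hr with hr | hr
  · rw [abs_of_nonpos (by linarith)]; simp only [radialBump]; linarith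
  · rw [abs_of_nonneg (by linarith)]; simp only [radialBump]; linarith

lemma deriv_radialBump_eq_zero {r : ℝ} (hr : r < 1 ∨ 3 < r) : deriv radialBump r = 0 := by
  have : radialBump =ᶠ[nhds r] fun _ => (0 : ℝ) := by
    rcases hr with hr | hr
    · filter_upwards [gt_mem_nhds hr] with s hs using radialBump_eq_zero (Or.inl hs.le)
    · filter_upwards [lt_mem_nhds hr] with s hs using radialBump_eq_zero (Or.inr hs.le)
  rw [this.deriv_eq]; simp

lemma hasDerivAt_radialBump (r : ℝ) : HasDerivAt radialBump (deriv radialBump r) r :=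
  ((radialBump.contDiff (n := 1)).differentiable (by simp) r).hasDerivAt

lemma continuous_deriv_radialBump : Continuous (deriv radialBump) :=
  (radialBump.contDiff (n := 1)).continuous_deriv (by simp)

lemma hasFDerivAt_norm_of_ne_zero {y : E3} (hy : y ≠ 0) :
    HasFDerivAt (fun w : E3 => ‖w‖) (‖y‖⁻¹ • innerSL ℝ y) y := by
  have h1 : HasFDerivAt (fun w : E3 => √(‖w‖ ^ 2)) _ y :=
    (hasStrictFDerivAt_norm_sq y).hasFDerivAt.sqrt (by simpa using hy)
  simp only [Real.sqrt_sq (norm_nonneg _)] at h1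
  refine h1.congr_fderiv ?_
  ext v
  simp
  ring

lemma pdC_radialBump (i : Fin 3) (y : E3) :
    pdC (fun y : E3 => ((radialBump ‖y‖ : ℝ) : ℂ)) i y =
      ((deriv radialBump ‖y‖ : ℝ) : ℂ) * (unitize y i : ℂ) := by
  by_cases hy : y = 0
  · subst hy
    have : (fun y : E3 => ((radialBump ‖y‖ : ℝ) : ℂ)) =ᶠ[nhds 0] fun _ => (0 : ℂ) := by
      filter_upwards [Metric.ball_mem_nhds (0 : E3) one_pos] with w hw
      rw [radialBump_eq_zero (Or.inl (by simpa using (mem_ball_zero_iff.mp hw).le))]; simp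
    rw [pdC, this.fderiv_eq]
    simp [unitize]
  · have h4 := (hasDerivAt_radialBump ‖y‖).ofReal_comp.hasFDerivAt.comp y
      (hasFDerivAt_norm_of_ne_zero hy)
    rw [pdC, HasFDerivAt.fderiv (by simpa [Function.comp_def] using! h4)]
    simp [unitize, PiLp.inner_apply]
    ring

lemma radialBump_integral (d : ℤ) :
    (∫ r in Set.Ioi (0 : ℝ), (r : ℂ) ^ 2 * (((deriv radialBump r : ℝ) : ℂ) * (r : ℂ) ^ d)) =
      -(d + 2) * ∫ r in Set.Ioi (0 : ℝ), (r : ℂ) ^ 2 * ((radialBump r : ℂ) * (r : ℂ) ^ (d - 1)) := by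
  have key : ∀ f : ℝ → ℂ, (∀ r, r < 1 ∨ 3 < r → f r = 0) →
      ∫ r in Set.Ioi (0 : ℝ), f r = ∫ r in (1/2 : ℝ)..4, f r := by
    intro f hf
    rw [intervalIntegral.integral_of_le (by norm_num)]
    apply setIntegral_eq_of_subset_of_forall_sdiff_eq_zero measurableSet_Ioi
    · intro r hr
      exact Set.mem_Ioi.mpr (by linarith [hr.1])
    · rintro r ⟨h1, h2⟩
      apply hf
      by_contra! h
      exact h2 ⟨by linarith, by linarith⟩
  rw [key _ (fun r hr => by simp [deriv_radialBump_eq_zero hr]),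
    key _ (fun r hr => by simp [radialBump_eq_zero (hr.imp le_of_lt le_of_lt)])]
  have hpos : ∀ r ∈ Set.uIcc (1/2 : ℝ) 4, (r : ℂ) ≠ 0 := by
    intro r hr
    rw [Set.uIcc_of_le (by norm_num)] at hr
    exact_mod_cast (by linarith [hr.1] : 0 < r).ne'
  have hzc : ∀ k : ℤ, ContinuousOn (fun r : ℝ => (r : ℂ) ^ k) (Set.uIcc (1/2 : ℝ) 4) := by
    intro k r hr
    exact (Complex.continuous_ofReal.continuousAt.zpow₀ k (Or.inl (hpos r hr))).continuousWithinAt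
  have hc1 : ContinuousOn (fun r : ℝ => (r : ℂ) ^ 2 * (((deriv radialBump r : ℝ) : ℂ) * (r : ℂ) ^ d))
      (Set.uIcc (1/2 : ℝ) 4) := by
    refine (Continuous.continuousOn (by fun_prop)).mul (ContinuousOn.mul ?_ (hzc d))
    exact (Complex.continuous_ofReal.comp continuous_deriv_radialBump).continuousOn
  have hc2 : ContinuousOn (fun r : ℝ => (r : ℂ) ^ 2 * ((radialBump r : ℂ) * (r : ℂ) ^ (d - 1)))
      (Set.uIcc (1/2 : ℝ) 4) := by
    refine (Continuous.continuousOn (by fun_prop)).mul (ContinuousOn.mul ?_ (hzc _))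
    exact (Complex.continuous_ofReal.comp radialBump.continuous).continuousOn
  rw [← intervalIntegral.integral_const_mul, ← sub_eq_zero, ← intervalIntegral.integral_sub
    hc1.intervalIntegrable (hc2.intervalIntegrable.const_mul _)]
  rw [intervalIntegral.integral_eq_sub_of_hasDerivAt
    (f := fun r : ℝ => (radialBump r : ℂ) * (r : ℂ) ^ (d + 2))]
  · simp [radialBump_eq_zero (r := 4) (Or.inr (by norm_num)),
      radialBump_eq_zero (r := 2⁻¹) (Or.inl (by norm_num))]
  · intro r hr
    have h0 := hpos r hr
    have h1 := (hasDerivAt_radialBump r).ofReal_comp.mul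
      ((hasDerivAt_zpow (d + 2) (r : ℂ) (Or.inl h0)).comp_ofReal)
    refine HasDerivAt.congr_deriv h1 ?_
    have e1 : (r : ℂ) ^ (d + 2) = (r : ℂ) ^ 2 * (r : ℂ) ^ d := by
      rw [zpow_add₀ h0]; norm_cast; ring
    have e2 : (r : ℂ) ^ (d + 2 - 1) = (r : ℂ) ^ 2 * (r : ℂ) ^ (d - 1) := by
      rw [add_sub_right_comm, zpow_add₀ h0]; norm_cast; ring
    rw [e1, e2]
    push_cast
    ring
  · exact (hc1.sub (continuousOn_const.mul hc2)).intervalIntegrable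

lemma radialBump_integral_ne_zero (d : ℤ) :
    (∫ r in Set.Ioi (0 : ℝ), (r : ℂ) ^ 2 * ((radialBump r : ℂ) * (r : ℂ) ^ d)) ≠ 0 := by
  have e : (∫ r in Set.Ioi (0 : ℝ), (r : ℂ) ^ 2 * ((radialBump r : ℂ) * (r : ℂ) ^ d)) =
      ((∫ r in (1 : ℝ)..3, r ^ 2 * (radialBump r * r ^ d) : ℝ) : ℂ) := by
    rw [← intervalIntegral.integral_ofReal, intervalIntegral.integral_of_le (by norm_num)]
    push_cast
    apply setIntegral_eq_of_subset_of_forall_sdiff_eq_zero measurableSet_Ioi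
    · intro r hr
      exact Set.mem_Ioi.mpr (by linarith [hr.1])
    · rintro r ⟨h1, h2⟩
      have : r ≤ 1 ∨ 3 ≤ r := by
        by_contra! h
        exact h2 ⟨by linarith, by linarith⟩
      simp [radialBump_eq_zero this]
  rw [e]
  refine Complex.ofReal_ne_zero.mpr (ne_of_gt ?_)
  apply intervalIntegral.intervalIntegral_pos_of_pos_on
  · apply ContinuousOn.intervalIntegrable
    intro r hr
    rw [Set.uIcc_of_le (by norm_num)] at hr
    apply ContinuousAt.continuousWithinAt
    have := radialBump.continuous
    exact (by fun_prop : ContinuousAt (fun r : ℝ => r ^ 2) r).mul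
      (this.continuousAt.mul (continuousAt_id.zpow₀ d (Or.inl (by simp; linarith [hr.1]))))
  · intro r hr
    have h1 : 0 < radialBump r := by
      apply radialBump.pos_of_mem_ball
      rw [Metric.mem_ball, Real.dist_eq, abs_lt]
      simp only [radialBump]
      constructor <;> linarith [hr.1, hr.2]
    have h2 : 0 < r := by linarith [hr.1]
    positivity
  · norm_num

lemma integrable_of_radial {a : ℝ → ℂ} (ha : Continuous a) (ha0 : ∀ r, r < 1 ∨ 3 < r → a r = 0)
    {h : E3 → ℂ} (hh : SmoothOff h) : Integrable (fun y : E3 => a ‖y‖ * h y) := by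
  have hK : IsCompact (Metric.closedBall (0 : E3) 3 \ Metric.ball 0 1) :=
    (isCompact_closedBall _ _).diff Metric.isOpen_ball
  rw [← integrableOn_iff_integrable_of_support_subset
    (s := Metric.closedBall (0 : E3) 3 \ Metric.ball 0 1)]
  · apply ContinuousOn.integrableOn_compact hK
    refine (ha.comp continuous_norm).continuousOn.mul (ContDiffOn.continuousOn hh |>.mono ?_)
    rintro y ⟨-, hy⟩ rfl
    simp at hy
  · intro y hy
    by_contra hy'
    apply hy
    simp only [Set.mem_sdiff, Metric.mem_closedBall, dist_zero_right, Metric.mem_ball, not_and_or,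
      not_not, not_le] at hy'
    simp [ha0 ‖y‖ hy'.symm]

/-- The divergence formula on the sphere for functions homogeneous of degree `d`. -/
theorem integral_sphere_pdC {d : ℤ} {h : E3 → ℂ} (hh : IsHomog d h) (hs : SmoothOff h)
    (i : Fin 3) :
    ∫ v : Metric.sphere (0 : E3) 1, pdC h i v ∂sphereMeasure =
      (d + 2) * ∫ v : Metric.sphere (0 : E3) 1, (v.1 i : ℂ) * h v ∂sphereMeasure := by
  have hb : Continuous (fun r : ℝ => (radialBump r : ℂ)) :=
    Complex.continuous_ofReal.comp radialBump.continuous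
  have hb' : Continuous (fun r : ℝ => ((deriv radialBump r : ℝ) : ℂ)) :=
    Complex.continuous_ofReal.comp continuous_deriv_radialBump
  have hb0 : ∀ r, r < 1 ∨ 3 < r → (radialBump r : ℂ) = 0 := fun r hr => by
    simp [radialBump_eq_zero (hr.imp le_of_lt le_of_lt)]
  have hb0' : ∀ r, r < 1 ∨ 3 < r → ((deriv radialBump r : ℝ) : ℂ) = 0 := fun r hr => by
    simp [deriv_radialBump_eq_zero hr]
  have hu : SmoothOff (fun y : E3 => (unitize y i : ℂ)) := by
    have : ContDiffOn ℝ (⊤ : ℕ∞) (fun y : E3 => ‖y‖⁻¹ * y i) {x : E3 | x ≠ 0} := by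
      refine ContDiffOn.mul (ContDiffOn.inv (contDiffOn_id.norm ℝ (fun y hy => hy))
        (fun y hy => norm_ne_zero_iff.mpr hy)) ?_
      exact (EuclideanSpace.proj (𝕜 := ℝ) i).contDiff.contDiffOn
    exact Complex.ofRealCLM.contDiff.comp_contDiffOn this
  have ibp := integral_mul_fderiv_eq_neg_fderiv_mul_of_integrable (μ := (volume : Measure E3))
    (f := fun y : E3 => ((radialBump ‖y‖ : ℝ) : ℂ)) (g := h) (v := EuclideanSpace.single i 1)
    ?_ (integrable_of_radial hb hb0 (hs.pdC i)) (integrable_of_radial hb hb0 hs) ?_ ?_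
  · have e1 : (∫ y : E3, ((radialBump ‖y‖ : ℝ) : ℂ) * fderiv ℝ h y (EuclideanSpace.single i 1)) =
        ∫ y : E3, (fun r : ℝ => (radialBump r : ℂ) * (r : ℂ) ^ (d - 1)) ‖y‖ * pdC h i (unitize y) := by
      congr 1
      ext y
      by_cases hy : y = 0
      · simp [hy, radialBump_eq_zero (r := 0) (Or.inl zero_le_one)]
      · change _ * pdC h i y = _
        rw [(hh.pdC hs i).eq_unitize hy]
        ring
    have e2 : (∫ y : E3, fderiv ℝ (fun y : E3 => ((radialBump ‖y‖ : ℝ) : ℂ)) y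
          (EuclideanSpace.single i 1) * h y) =
        ∫ y : E3, (fun r : ℝ => ((deriv radialBump r : ℝ) : ℂ) * (r : ℂ) ^ d) ‖y‖ *
          (fun u : E3 => (u i : ℂ) * h u) (unitize y) := by
      congr 1
      ext y
      change pdC (fun y : E3 => ((radialBump ‖y‖ : ℝ) : ℂ)) i y * h y = _
      rw [pdC_radialBump]
      by_cases hy : y = 0
      · simp [hy, deriv_radialBump_eq_zero (r := 0) (Or.inl zero_lt_one)]
      · rw [hh.eq_unitize hy]
        ring
    rw [e1, e2, integral_polar (fun r : ℝ => (radialBump r : ℂ) * (r : ℂ) ^ (d - 1)),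
      integral_polar (fun r : ℝ => ((deriv radialBump r : ℝ) : ℂ) * (r : ℂ) ^ d)
        (fun u : E3 => (u i : ℂ) * h u), radialBump_integral] at ibp
    have := radialBump_integral_ne_zero (d - 1)
    apply mul_left_cancel₀ this
    rw [ibp]
    ring
  · refine (integrable_of_radial hb' hb0' (hu.mul hs)).congr (Filter.Eventually.of_forall ?_)
    intro y
    change _ = pdC (fun y : E3 => ((radialBump ‖y‖ : ℝ) : ℂ)) i y * h y
    rw [pdC_radialBump]
    ring
  · intro y _
    by_cases hy : y = 0
    · subst hy
      have : (fun y : E3 => ((radialBump ‖y‖ : ℝ) : ℂ)) =ᶠ[nhds 0] fun _ => (0 : ℂ) := by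
        filter_upwards [Metric.ball_mem_nhds (0 : E3) one_pos] with w hw
        rw [radialBump_eq_zero (Or.inl (by simpa using (mem_ball_zero_iff.mp hw).le))]; simp
      exact (differentiableAt_const _).congr_of_eventuallyEq this
    · exact Complex.ofRealCLM.differentiableAt.comp y
        (((radialBump.contDiff (n := 1)).differentiable (by simp) _).comp y
          (differentiableAt_id.norm ℝ hy))
  · intro y hy
    apply hs.differentiableAt
    rintro rfl
    refine notMem_tsupport_iff_eventuallyEq.mpr ?_ hy
    filter_upwards [Metric.ball_mem_nhds (0 : E3) one_pos] with w hw
    rw [radialBump_eq_zero (Or.inl (by simpa using (mem_ball_zero_iff.mp hw).le))]; simp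
/-- Harmonic functions on the punctured space, homogeneous of degree `n`. -/
structure IsSolid (n : ℤ) (F : E3 → ℂ) : Prop where
  smooth : SmoothOff F
  homog : IsHomog n F
  harm : ∀ y : E3, y ≠ 0 → lapC F y = 0

lemma IsHomog.mul {d e : ℤ} {f g : E3 → ℂ} (hf : IsHomog d f) (hg : IsHomog e g) :
    IsHomog (d + e) (fun y => f y * g y) := by
  intro c hc y hy
  have hc' : (c : ℂ) ≠ 0 := by exact_mod_cast hc.ne'
  simp only [hf c hc y hy, hg c hc y hy, zpow_add₀ hc']
  ring

lemma IsHomog.sub {d : ℤ} {f g : E3 → ℂ} (hf : IsHomog d f) (hg : IsHomog d g) :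
    IsHomog d (fun y => f y - g y) := by
  intro c hc y hy
  simp only [hf c hc y hy, hg c hc y hy]
  ring

lemma IsHomog.sum {ι : Type*} {s : Finset ι} {d : ℤ} {f : ι → E3 → ℂ}
    (hf : ∀ j ∈ s, IsHomog d (f j)) : IsHomog d (fun y => ∑ j ∈ s, f j y) := by
  intro c hc y hy
  simp only [Finset.mul_sum]
  exact Finset.sum_congr rfl fun j hj => hf j hj c hc y hy

lemma IsHomog.const_mul {d : ℤ} {f : E3 → ℂ} (a : ℂ) (hf : IsHomog d f) :
    IsHomog d (fun y => a * f y) := by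
  intro c hc y hy
  simp only [hf c hc y hy]
  ring

lemma IsHomog.conj {d : ℤ} {f : E3 → ℂ} (hf : IsHomog d f) :
    IsHomog d (fun y => (starRingEnd ℂ) (f y)) := by
  intro c hc y hy
  simp [hf c hc y hy]

lemma pdC_mul {f g : E3 → ℂ} (hf : SmoothOff f) (hg : SmoothOff g) {y : E3} (hy : y ≠ 0)
    (i : Fin 3) : pdC (fun y => f y * g y) i y = pdC f i y * g y + f y * pdC g i y := by
  rw [pdC, fderiv_fun_mul (hf.differentiableAt hy) (hg.differentiableAt hy)]
  simp [pdC]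
  ring

lemma pdC_sub {f g : E3 → ℂ} (hf : SmoothOff f) (hg : SmoothOff g) {y : E3} (hy : y ≠ 0)
    (i : Fin 3) : pdC (fun y => f y - g y) i y = pdC f i y - pdC g i y := by
  rw [pdC, fderiv_fun_sub (hf.differentiableAt hy) (hg.differentiableAt hy)]
  simp [pdC]

lemma pdC_sum {ι : Type*} {s : Finset ι} {f : ι → E3 → ℂ} (hf : ∀ j ∈ s, SmoothOff (f j))
    {y : E3} (hy : y ≠ 0) (i : Fin 3) :
    pdC (fun y => ∑ j ∈ s, f j y) i y = ∑ j ∈ s, pdC (f j) i y := by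
  rw [pdC, fderiv_fun_sum fun j hj => (hf j hj).differentiableAt hy]
  simp [pdC]

lemma pdC_const_mul {f : E3 → ℂ} (a : ℂ) (hf : SmoothOff f) {y : E3} (hy : y ≠ 0)
    (i : Fin 3) : pdC (fun y => a * f y) i y = a * pdC f i y := by
  rw [pdC, fderiv_const_mul (hf.differentiableAt hy)]
  simp [pdC]

lemma pdC_conj (f : E3 → ℂ) (y : E3) (i : Fin 3) :
    pdC (fun y => (starRingEnd ℂ) (f y)) i y = (starRingEnd ℂ) (pdC f i y) := by
  have := (Complex.conjCLE : ℂ ≃L[ℝ] ℂ).comp_fderiv (f := f) (x := y)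
  simp only [pdC]
  have h2 := congrArg (fun L => L (EuclideanSpace.single i (1 : ℝ))) this
  simpa [Function.comp_def] using! h2

lemma pdC_congr {f g : E3 → ℂ} (hfg : ∀ y : E3, y ≠ 0 → f y = g y) {y : E3} (hy : y ≠ 0)
    (i : Fin 3) : pdC f i y = pdC g i y := by
  have : f =ᶠ[nhds y] g := by
    filter_upwards [isOpen_ne_zero.mem_nhds hy] with w hw using hfg w hw
  rw [pdC, pdC, this.fderiv_eq]

lemma two_le_coe_top : (2 : WithTop ℕ∞) ≤ ((⊤ : ℕ∞) : WithTop ℕ∞) :=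
  WithTop.coe_le_coe.mpr (le_top : (2 : ℕ∞) ≤ ⊤)

lemma pdC_comm {f : E3 → ℂ} (hf : SmoothOff f) {y : E3} (hy : y ≠ 0) (i j : Fin 3) :
    pdC (pdC f i) j y = pdC (pdC f j) i y := by
  have h1 : ∀ v : E3, fderiv ℝ (fun w => fderiv ℝ f w v) y = (fderiv ℝ (fderiv ℝ f) y).flip v := by
    intro v
    have h2 : DifferentiableAt ℝ (fderiv ℝ f) y :=
      ((hf.contDiffAt hy).fderiv_right (m := 1)
        (one_add_one_eq_two.trans_le two_le_coe_top)).differentiableAt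
        (by simp)
    have := h2.hasFDerivAt.clm_apply (hasFDerivAt_const v y)
    rw [this.fderiv]
    simp
  have hsymm := (hf.contDiffAt hy).isSymmSndFDerivAt
    (by simpa using two_le_coe_top)
  change fderiv ℝ (fun w => fderiv ℝ f w (EuclideanSpace.single i 1)) y _ =
    fderiv ℝ (fun w => fderiv ℝ f w (EuclideanSpace.single j 1)) y _
  rw [h1, h1]
  exact hsymm _ _

lemma IsSolid.pdC {n : ℤ} {F : E3 → ℂ} (hF : IsSolid n F) (i : Fin 3) :
    IsSolid (n - 1) (pdC F i) := by
  refine ⟨hF.smooth.pdC i, hF.homog.pdC hF.smooth i, fun y hy => ?_⟩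
  have h1 : ∀ j, _root_.pdC (_root_.pdC (_root_.pdC F i) j) j y =
      _root_.pdC (_root_.pdC (_root_.pdC F j) j) i y := by
    intro j
    rw [pdC_congr (fun w hw => pdC_comm hF.smooth hw i j) hy, pdC_comm (hF.smooth.pdC j) hy]
  simp only [lapC, h1]
  rw [← pdC_sum (fun j _ => (hF.smooth.pdC j).pdC j) hy,
    pdC_congr (g := fun _ => 0) (fun w hw => by simpa only [lapC] using hF.harm w hw) hy]
  simp [_root_.pdC]

lemma IsSolid.sum {ι : Type*} {s : Finset ι} {n : ℤ} {f : ι → E3 → ℂ}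
    (hf : ∀ j ∈ s, IsSolid n (f j)) : IsSolid n (fun y => ∑ j ∈ s, f j y) := by
  refine ⟨SmoothOff.sum fun j hj => (hf j hj).smooth, IsHomog.sum fun j hj => (hf j hj).homog,
    fun y hy => ?_⟩
  have h1 : ∀ i, _root_.pdC (_root_.pdC (fun y => ∑ j ∈ s, f j y) i) i y =
      ∑ j ∈ s, _root_.pdC (_root_.pdC (f j) i) i y := by
    intro i
    rw [pdC_congr (fun w hw => pdC_sum (fun j hj => (hf j hj).smooth) hw i) hy,
      pdC_sum (fun j hj => (hf j hj).smooth.pdC i) hy]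
  simp only [lapC, h1]
  rw [Finset.sum_comm]
  exact Finset.sum_eq_zero fun j hj => (hf j hj).harm y hy

lemma IsSolid.sub {n : ℤ} {f g : E3 → ℂ} (hf : IsSolid n f) (hg : IsSolid n g) :
    IsSolid n (fun y => f y - g y) := by
  refine ⟨hf.smooth.sub hg.smooth, hf.homog.sub hg.homog, fun y hy => ?_⟩
  have h1 : ∀ i, _root_.pdC (_root_.pdC (fun y => f y - g y) i) i y =
      _root_.pdC (_root_.pdC f i) i y - _root_.pdC (_root_.pdC g i) i y := by
    intro i
    rw [pdC_congr (fun w hw => pdC_sub hf.smooth hg.smooth hw i) hy,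
      pdC_sub (hf.smooth.pdC i) (hg.smooth.pdC i) hy]
  simp only [lapC, h1, Finset.sum_sub_distrib]
  have := hf.harm y hy
  have := hg.harm y hy
  simp_all [lapC]

lemma IsSolid.const_mul {n : ℤ} {f : E3 → ℂ} (a : ℂ) (hf : IsSolid n f) :
    IsSolid n (fun y => a * f y) := by
  refine ⟨(SmoothOff.const a).mul hf.smooth, hf.homog.const_mul a, fun y hy => ?_⟩
  have h1 : ∀ i, _root_.pdC (_root_.pdC (fun y => a * f y) i) i y =
      a * _root_.pdC (_root_.pdC f i) i y := by
    intro i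
    rw [pdC_congr (fun w hw => pdC_const_mul a hf.smooth hw i) hy,
      pdC_const_mul a (hf.smooth.pdC i) hy]
  simp only [lapC, h1, ← Finset.mul_sum]
  have := hf.harm y hy
  simp_all [lapC]

lemma IsSolid.conj {n : ℤ} {f : E3 → ℂ} (hf : IsSolid n f) :
    IsSolid n (fun y => (starRingEnd ℂ) (f y)) := by
  refine ⟨hf.smooth.conj, hf.homog.conj, fun y hy => ?_⟩
  have h1 : ∀ i, _root_.pdC (_root_.pdC (fun y => (starRingEnd ℂ) (f y)) i) i y =
      (starRingEnd ℂ) (_root_.pdC (_root_.pdC f i) i y) := by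
    intro i
    rw [pdC_congr (fun w hw => pdC_conj f w i) hy, pdC_conj]
  simp only [lapC, h1, ← map_sum]
  have := hf.harm y hy
  simp_all [lapC]

lemma sphere_ne_zero (v : Metric.sphere (0 : E3) 1) : (v : E3) ≠ 0 :=
  Metric.ne_of_mem_sphere v.2 one_ne_zero

lemma integral_sphere_sum_pdC {d : ℤ} {h : Fin 3 → E3 → ℂ} (hh : ∀ i, IsHomog d (h i))
    (hs : ∀ i, SmoothOff (h i)) :
    ∫ v : Metric.sphere (0 : E3) 1, ∑ i, pdC (h i) i v ∂sphereMeasure =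
      (d + 2) * ∫ v : Metric.sphere (0 : E3) 1, ∑ i, (v.1 i : ℂ) * h i v ∂sphereMeasure := by
  rw [integral_finsetSum _ fun i _ => ((hs i).pdC i).integrable,
    integral_finsetSum _ fun i _ => ((SmoothOff.coord i).mul (hs i)).integrable, Finset.mul_sum]
  exact Finset.sum_congr rfl fun i _ => integral_sphere_pdC (hh i) (hs i) i

theorem IsSolid.integral_mul_eq_zero {n k : ℤ} {F G : E3 → ℂ} (hF : IsSolid n F)
    (hG : IsSolid k G) (hnk : n ≠ k) (hnk' : n + k + 1 ≠ 0) :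
    ∫ v : Metric.sphere (0 : E3) 1, F v * G v ∂sphereMeasure = 0 := by
  have h1 := integral_sphere_sum_pdC (d := n + k - 1)
    (h := fun i y => F y * _root_.pdC G i y - G y * _root_.pdC F i y)
    (fun i => by
      refine IsHomog.sub ?_ ?_
      · convert hF.homog.mul (hG.homog.pdC hG.smooth i) using 1; ring
      · convert hG.homog.mul (hF.homog.pdC hF.smooth i) using 1; ring)
    (fun i => (hF.smooth.mul (hG.smooth.pdC i)).sub (hG.smooth.mul (hF.smooth.pdC i)))
  have h2 : ∀ v : Metric.sphere (0 : E3) 1, ∑ i, _root_.pdC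
      (fun y => F y * _root_.pdC G i y - G y * _root_.pdC F i y) i v = 0 := by
    intro v
    have hv := sphere_ne_zero v
    have e : ∀ i, _root_.pdC (fun y => F y * _root_.pdC G i y - G y * _root_.pdC F i y) i v =
        F v * _root_.pdC (_root_.pdC G i) i v - G v * _root_.pdC (_root_.pdC F i) i v := by
      intro i
      rw [pdC_sub (hF.smooth.mul (hG.smooth.pdC i)) (hG.smooth.mul (hF.smooth.pdC i)) hv,
        pdC_mul hF.smooth (hG.smooth.pdC i) hv, pdC_mul hG.smooth (hF.smooth.pdC i) hv]
      ring
    simp only [e, Finset.sum_sub_distrib, ← Finset.mul_sum]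
    have := hF.harm v hv
    have := hG.harm v hv
    simp_all [lapC]
  have h3 : ∀ v : Metric.sphere (0 : E3) 1,
      ∑ i, (v.1 i : ℂ) * (F v * _root_.pdC G i v - G v * _root_.pdC F i v) =
        (k - n) * (F v * G v) := by
    intro v
    have hv := sphere_ne_zero v
    have e1 := hF.homog.euler hF.smooth hv
    have e2 := hG.homog.euler hG.smooth hv
    calc _ = F v * (∑ i, (v.1 i : ℂ) * _root_.pdC G i v)
          - G v * ∑ i, (v.1 i : ℂ) * _root_.pdC F i v := by
          rw [Finset.mul_sum, Finset.mul_sum, ← Finset.sum_sub_distrib]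
          exact Finset.sum_congr rfl fun i _ => by ring
      _ = _ := by rw [e1, e2]; ring
  simp only [h2, h3, integral_zero, integral_const_mul] at h1
  have c1 : ((n + k - 1 : ℤ) : ℂ) + 2 ≠ 0 := by
    have : (n + k - 1 : ℤ) + 2 ≠ 0 := by omega
    exact_mod_cast this
  have c2 : (k : ℂ) - n ≠ 0 := by
    have : k - n ≠ 0 := by omega
    exact_mod_cast this
  exact (mul_eq_zero.mp ((mul_eq_zero.mp h1.symm).resolve_left c1)).resolve_left c2

lemma eq_zero_of_integral_sphere_norm_sq {ι : Type*} {s : Finset ι} {f : ι → E3 → ℂ}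
    (hf : ∀ j ∈ s, SmoothOff (f j))
    (h : ∫ v : Metric.sphere (0 : E3) 1, ∑ j ∈ s, (starRingEnd ℂ) (f j v) * f j v
      ∂sphereMeasure = 0) (v : Metric.sphere (0 : E3) 1) : ∀ j ∈ s, f j v = 0 := by
  have e : ∀ v : Metric.sphere (0 : E3) 1, ∑ j ∈ s, (starRingEnd ℂ) (f j v) * f j v =
      ((∑ j ∈ s, ‖f j v‖ ^ 2 : ℝ) : ℂ) := by
    intro v
    push_cast
    exact Finset.sum_congr rfl fun j _ => by rw [mul_comm, Complex.mul_conj']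
  simp only [e] at h
  rw [integral_complex_ofReal] at h
  have hc : Continuous fun v : Metric.sphere (0 : E3) 1 => ∑ j ∈ s, ‖f j v‖ ^ 2 :=
    continuous_finsetSum _ fun j hj => ((hf j hj).continuous_sphere.norm).pow 2
  have h2 := (integral_eq_zero_iff_of_nonneg (fun v => by positivity)
    (hc.integrable_of_hasCompactSupport (HasCompactSupport.of_compactSpace _))).mp
    (by exact_mod_cast h)
  have h3 := congrFun ((Continuous.ae_eq_iff_eq sphereMeasure hc continuous_const).mp h2) v
  have h4 := (Finset.sum_eq_zero_iff_of_nonneg (fun j _ => by positivity)).mp h3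
  intro j hj
  simpa using h4 j hj

lemma IsSolid.eq_of_degree_zero {F : E3 → ℂ} (hF : IsSolid 0 F) {x y : E3} (hx : x ≠ 0)
    (hy : y ≠ 0) : F x = F y := by
  have h1 := integral_sphere_sum_pdC (d := -1)
    (h := fun i y => (starRingEnd ℂ) (F y) * _root_.pdC F i y)
    (fun i => by
      convert hF.homog.conj.mul (hF.homog.pdC hF.smooth i) using 1; norm_num)
    (fun i => hF.smooth.conj.mul (hF.smooth.pdC i))
  have h2 : ∀ v : Metric.sphere (0 : E3) 1, ∑ i, _root_.pdC
      (fun y => (starRingEnd ℂ) (F y) * _root_.pdC F i y) i v =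
        ∑ i, (starRingEnd ℂ) (_root_.pdC F i v) * _root_.pdC F i v := by
    intro v
    have hv := sphere_ne_zero v
    have e : ∀ i, _root_.pdC (fun y => (starRingEnd ℂ) (F y) * _root_.pdC F i y) i v =
        (starRingEnd ℂ) (_root_.pdC F i v) * _root_.pdC F i v
          + (starRingEnd ℂ) (F v) * _root_.pdC (_root_.pdC F i) i v := by
      intro i
      rw [pdC_mul hF.smooth.conj (hF.smooth.pdC i) hv, pdC_conj]
    simp only [e, Finset.sum_add_distrib, ← Finset.mul_sum]
    have := hF.harm v hv
    simp_all [lapC]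
  have h3 : ∀ v : Metric.sphere (0 : E3) 1,
      ∑ i, (v.1 i : ℂ) * ((starRingEnd ℂ) (F v) * _root_.pdC F i v) = 0 := by
    intro v
    have e1 := hF.homog.euler hF.smooth (sphere_ne_zero v)
    calc _ = (starRingEnd ℂ) (F v) * (∑ i, (v.1 i : ℂ) * _root_.pdC F i v) := by
          rw [Finset.mul_sum]
          exact Finset.sum_congr rfl fun i _ => by ring
      _ = _ := by rw [e1]; simp
  simp only [h2, h3, integral_zero, mul_zero] at h1
  have h4 : ∀ w : E3, w ≠ 0 → fderiv ℝ F w = 0 := by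
    intro w hw
    ext v
    rw [fderiv_eq_sum_pdC]
    have : ∀ i, _root_.pdC F i w = 0 := by
      intro i
      rw [(hF.homog.pdC hF.smooth i).eq_unitize hw]
      rw [eq_zero_of_integral_sphere_norm_sq (s := Finset.univ) (fun j _ => hF.smooth.pdC j) h1
        ⟨unitize w, by simp [norm_unitize hw]⟩ i (Finset.mem_univ _), mul_zero]
    simp [this]
  have hconn : IsPreconnected {x : E3 | x ≠ 0} :=
    (isConnected_compl_singleton_of_one_lt_rank (E := E3) (by
      rw [← Module.finrank_eq_rank]; simp) 0).isPreconnected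
  exact isOpen_ne_zero.is_const_of_fderiv_eq_zero hconn
    (fun w hw => (hF.smooth.differentiableAt hw).differentiableWithinAt) (fun w hw => h4 w hw) hx hy

/-- The homogenized Legendre polynomial: `legendreG n s q = q ^ (n / 2) * Pₙ (s / √q)`. -/
noncomputable def legendreG : ℕ → ℝ → ℝ → ℝ
  | 0, _, _ => 1
  | 1, s, _ => s
  | k + 2, s, q =>
    ((2 * k + 3) * s * legendreG (k + 1) s q - (k + 1) * q * legendreG k s q) / (k + 2)

/-- The derivative of `legendreG n s q` with respect to `s`. -/
noncomputable def legendreA : ℕ → ℝ → ℝ → ℝ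
  | 0, _, _ => 0
  | n + 1, s, q => s * legendreA n s q + (n + 1) * legendreG n s q

lemma legendreG_add_two (k : ℕ) (s q : ℝ) : (k + 2) * legendreG (k + 2) s q =
    (2 * k + 3) * s * legendreG (k + 1) s q - (k + 1) * q * legendreG k s q := by
  rw [legendreG]
  field_simp

lemma legendreA_succ (n : ℕ) (s q : ℝ) :
    legendreA (n + 1) s q = s * legendreA n s q + (n + 1) * legendreG n s q := rfl

lemma mul_legendreA_succ_sub (n : ℕ) (s q : ℝ) :
    s * legendreA (n + 1) s q - q * legendreA n s q = (n + 1) * legendreG (n + 1) s q := by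
  induction n with
  | zero => simp [legendreA, legendreG]
  | succ n ih =>
    have h := legendreG_add_two n s q
    rw [legendreA_succ (n + 1), legendreA_succ n]
    rw [legendreA_succ n] at ih
    push_cast
    linear_combination s * ih - h

lemma legendreG_smul (n : ℕ) (c s q : ℝ) :
    legendreG n (c * s) (c ^ 2 * q) = c ^ n * legendreG n s q := by
  induction n using Nat.twoStepInduction with
  | zero => simp [legendreG]
  | one => simp [legendreG]
  | more n h1 h2 => rw [legendreG, legendreG, h1, h2]; ring

lemma mul_legendreA_smul (n : ℕ) (c s q : ℝ) :
    c * legendreA n (c * s) (c ^ 2 * q) = c ^ n * legendreA n s q := by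
  induction n with
  | zero => simp [legendreA]
  | succ n h =>
    rw [legendreA, legendreA, legendreG_smul]
    linear_combination c * s * h

lemma legendreG_one_one (n : ℕ) : legendreG n 1 1 = 1 := by
  induction n using Nat.twoStepInduction with
  | zero => simp [legendreG]
  | one => simp [legendreG]
  | more n h1 h2 => rw [legendreG, h1, h2]; field_simp; ring

/-- The zonal solid harmonic of degree `n` with axis `e`. -/
noncomputable def zonalG (e : E3) (n : ℕ) (y : E3) : ℂ :=
  legendreG n (∑ i, e i * y i) (∑ i, y i ^ 2)

/-- The `s`-derivative of the homogenized Legendre polynomial along an axis `e`. -/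
noncomputable def zonalA (e : E3) (n : ℕ) (y : E3) : ℂ :=
  legendreA n (∑ i, e i * y i) (∑ i, y i ^ 2)

lemma zonalG_add_two (e : E3) (k : ℕ) (y : E3) : zonalG e (k + 2) y =
    ((2 * k + 3) / (k + 2)) * ((∑ i, (e i : ℂ) * y i) * zonalG e (k + 1) y) -
      ((k + 1) / (k + 2)) * ((∑ i, (y i : ℂ) * y i) * zonalG e k y) := by
  have h : ((k : ℂ) + 2) ≠ 0 := by exact_mod_cast (Nat.succ_ne_zero (k + 1))
  simp only [zonalG, legendreG, pow_two]
  push_cast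
  field_simp

lemma zonalA_succ (e : E3) (n : ℕ) (y : E3) : zonalA e (n + 1) y =
    (∑ i, (e i : ℂ) * y i) * zonalA e n y + (n + 1) * zonalG e n y := by
  simp [zonalG, zonalA, legendreA]

lemma mul_zonalA_succ_sub (e : E3) (n : ℕ) (y : E3) :
    (∑ i, (e i : ℂ) * y i) * zonalA e (n + 1) y - (∑ i, (y i : ℂ) * y i) * zonalA e n y =
      (n + 1) * zonalG e (n + 1) y := by
  have := mul_legendreA_succ_sub n (∑ i, e i * y i) (∑ i, y i ^ 2)
  simp only [zonalG, zonalA]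
  rw [← Complex.ofReal_inj] at this
  push_cast at this
  simpa only [← pow_two] using this

lemma smoothOff_linear (e : E3) : SmoothOff (fun y : E3 => ∑ i, (e i : ℂ) * y i) :=
  SmoothOff.sum fun i _ => (SmoothOff.const _).mul (SmoothOff.coord i)

lemma smoothOff_normSq : SmoothOff (fun y : E3 => ∑ i, (y i : ℂ) * y i) :=
  SmoothOff.sum fun i _ => (SmoothOff.coord i).mul (SmoothOff.coord i)

lemma smoothOff_zonalG (e : E3) (n : ℕ) : SmoothOff (zonalG e n) := by
  induction n using Nat.twoStepInduction with
  | zero => simpa [funext_iff, zonalG, legendreG] using! SmoothOff.const 1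
  | one =>
    convert smoothOff_linear e using 2 with y
    simp [zonalG, legendreG]
  | more n h1 h2 =>
    rw [funext (zonalG_add_two e n)]
    exact ((SmoothOff.const _).mul ((smoothOff_linear e).mul h2)).sub
      ((SmoothOff.const _).mul (smoothOff_normSq.mul h1))

lemma smoothOff_zonalA (e : E3) (n : ℕ) : SmoothOff (zonalA e n) := by
  induction n with
  | zero => simpa [funext_iff, zonalA, legendreA] using! SmoothOff.const 0
  | succ n h =>
    rw [funext (zonalA_succ e n)]
    exact ((smoothOff_linear e).mul h).add ((SmoothOff.const _).mul (smoothOff_zonalG e n))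

lemma isHomog_zonalG (e : E3) (n : ℕ) : IsHomog n (zonalG e n) := by
  intro c hc y hy
  have := legendreG_smul n c (∑ i, e i * y i) (∑ i, y i ^ 2)
  simp only [zonalG, PiLp.smul_apply, smul_eq_mul, mul_left_comm _ c, mul_pow, ← Finset.mul_sum,
    this]
  simp

lemma isHomog_zonalA (e : E3) (n : ℕ) : IsHomog (n - 1) (zonalA e n) := by
  intro c hc y hy
  have := mul_legendreA_smul n c (∑ i, e i * y i) (∑ i, y i ^ 2)
  have hc' : (c : ℂ) ≠ 0 := by exact_mod_cast hc.ne'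
  rw [← Complex.ofReal_inj] at this
  simp only [zonalA, PiLp.smul_apply, smul_eq_mul, mul_left_comm _ c, mul_pow, ← Finset.mul_sum]
  rw [zpow_sub_one₀ hc']
  push_cast at this ⊢
  field_simp
  simpa [mul_comm] using this

lemma pdC_coord (i j : Fin 3) (y : E3) :
    pdC (fun y : E3 => ((y j : ℝ) : ℂ)) i y = if j = i then 1 else 0 := by
  have h : HasFDerivAt (fun y : E3 => ((y j : ℝ) : ℂ))
      (Complex.ofRealCLM.comp (EuclideanSpace.proj (𝕜 := ℝ) j)) y :=
    (Complex.ofRealCLM.comp (EuclideanSpace.proj (𝕜 := ℝ) j)).hasFDerivAt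
  rw [pdC, h.fderiv]
  simp [apply_ite]

lemma pdC_const (c : ℂ) (i : Fin 3) (y : E3) : pdC (fun _ => c) i y = 0 := by simp [pdC]

lemma pdC_add {f g : E3 → ℂ} (hf : SmoothOff f) (hg : SmoothOff g) {y : E3} (hy : y ≠ 0)
    (i : Fin 3) : pdC (fun y => f y + g y) i y = pdC f i y + pdC g i y := by
  rw [pdC, fderiv_fun_add (hf.differentiableAt hy) (hg.differentiableAt hy)]
  simp [pdC]

lemma pdC_linear (e : E3) (i : Fin 3) {y : E3} (hy : y ≠ 0) :
    pdC (fun y : E3 => ∑ i, (e i : ℂ) * y i) i y = e i := by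
  rw [pdC_sum (fun j _ => (SmoothOff.const _).mul (SmoothOff.coord j)) hy]
  simp [pdC_const_mul _ (SmoothOff.coord _) hy, pdC_coord]

lemma pdC_normSq (i : Fin 3) {y : E3} (hy : y ≠ 0) :
    pdC (fun y : E3 => ∑ i, (y i : ℂ) * y i) i y = 2 * y i := by
  rw [pdC_sum (fun j _ => (SmoothOff.coord j).mul (SmoothOff.coord j)) hy]
  simp [pdC_mul (SmoothOff.coord _) (SmoothOff.coord _) hy, pdC_coord, Finset.sum_add_distrib,
    two_mul]

lemma pdC_zonalG_zero (e : E3) (i : Fin 3) (y : E3) : pdC (zonalG e 0) i y = 0 := by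
  have : zonalG e 0 = fun _ => 1 := by funext y; simp [zonalG, legendreG]
  rw [this, pdC_const]

lemma pdC_zonalG_add_two (e : E3) (n : ℕ) (i : Fin 3) {y : E3} (hy : y ≠ 0) :
    (n + 2) * pdC (zonalG e (n + 2)) i y =
      (2 * n + 3) * (e i * zonalG e (n + 1) y +
        (∑ i, (e i : ℂ) * y i) * pdC (zonalG e (n + 1)) i y) -
      (n + 1) * (2 * y i * zonalG e n y + (∑ i, (y i : ℂ) * y i) * pdC (zonalG e n) i y) := by
  have h : ((n : ℂ) + 2) ≠ 0 := by exact_mod_cast (Nat.succ_ne_zero (n + 1))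
  have s1 := (smoothOff_linear e).mul (smoothOff_zonalG e (n + 1))
  have s2 := smoothOff_normSq.mul (smoothOff_zonalG e n)
  rw [funext (zonalG_add_two e n), pdC_sub ((SmoothOff.const _).mul s1)
    ((SmoothOff.const _).mul s2) hy, pdC_const_mul _ s1 hy, pdC_const_mul _ s2 hy,
    pdC_mul (smoothOff_linear e) (smoothOff_zonalG e (n + 1)) hy,
    pdC_mul smoothOff_normSq (smoothOff_zonalG e n) hy, pdC_linear e i hy, pdC_normSq i hy]
  field_simp

lemma pdC_zonalG_succ (e : E3) (n : ℕ) (i : Fin 3) {y : E3} (hy : y ≠ 0) :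
    pdC (zonalG e (n + 1)) i y = e i * zonalA e (n + 1) y - y i * zonalA e n y := by
  have aux : ∀ n : ℕ, ((n : ℂ) + 2) ≠ 0 := fun n => by exact_mod_cast (Nat.succ_ne_zero (n + 1))
  have h0 : zonalG e 0 y = 1 := by simp [zonalG, legendreG]
  have h1 : zonalA e 0 y = 0 := by simp [zonalA, legendreA]
  have hz : pdC (zonalG e 1) i y = e i * zonalA e 1 y - y i * zonalA e 0 y := by
    have : zonalG e 1 = fun y : E3 => ∑ i, (e i : ℂ) * y i := by
      funext y; simp [zonalG, legendreG]
    rw [this, pdC_linear e i hy, zonalA_succ, h0, h1]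
    simp
  induction n using Nat.twoStepInduction with
  | zero => exact hz
  | one =>
    have h := pdC_zonalG_add_two e 0 i hy
    have a1 := mul_zonalA_succ_sub e 0 y
    have a2 := zonalA_succ e 1 y
    have a3 := zonalA_succ e 0 y
    rw [zero_add, hz, pdC_zonalG_zero] at h
    rw [h0] at h a3
    rw [h1] at a1 a3 h
    simp only [Nat.reduceAdd, zero_add] at *
    push_cast at *
    apply mul_left_cancel₀ (aux 0)
    push_cast
    rw [h, a2]
    linear_combination (e i : ℂ) * a1 + 2 * (y i : ℂ) * a3
  | more n ih0 ih =>
    have h := pdC_zonalG_add_two e (n + 1) i hy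
    rw [ih, ih0] at h
    have a1 := mul_zonalA_succ_sub e (n + 1) y
    have a2 := zonalA_succ e (n + 2) y
    have a3 := zonalA_succ e (n + 1) y
    have a4 := mul_zonalA_succ_sub e n y
    apply mul_left_cancel₀ (aux (n + 1))
    push_cast at *
    rw [h, a2]
    linear_combination (n + 2) * (e i : ℂ) * a1 - (n + 2) * (y i : ℂ) * a4 +
      (n + 3) * (y i : ℂ) * a3

lemma sum_pdC_zonalG (e : E3) (he : ∑ i, (e i : ℂ) * e i = 1) (n : ℕ) {y : E3} (hy : y ≠ 0) :
    ∑ i, (e i : ℂ) * pdC (zonalG e (n + 1)) i y = (n + 1) * zonalG e n y := by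
  have h := zonalA_succ e n y
  simp only [pdC_zonalG_succ e n _ hy, mul_sub, Finset.sum_sub_distrib, ← mul_assoc,
    ← Finset.sum_mul, he]
  rw [h]
  ring

lemma pdC_zonalA_succ (e : E3) (n : ℕ) (i : Fin 3) {y : E3} (hy : y ≠ 0) :
    pdC (zonalA e (n + 1)) i y = e i * zonalA e n y +
      (∑ i, (e i : ℂ) * y i) * pdC (zonalA e n) i y + (n + 1) * pdC (zonalG e n) i y := by
  rw [funext (zonalA_succ e n), pdC_add ((smoothOff_linear e).mul (smoothOff_zonalA e n))
    ((SmoothOff.const _).mul (smoothOff_zonalG e n)) hy,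
    pdC_mul (smoothOff_linear e) (smoothOff_zonalA e n) hy,
    pdC_const_mul _ (smoothOff_zonalG e n) hy, pdC_linear e i hy]

lemma sum_pdC_zonalA (e : E3) (he : ∑ i, (e i : ℂ) * e i = 1) (n : ℕ) {y : E3} (hy : y ≠ 0) :
    ∑ i, (e i : ℂ) * pdC (zonalA e (n + 1)) i y = (n + 2) * zonalA e n y := by
  have h1 : ∀ y, zonalA e 0 y = 0 := by intro y; simp [zonalA, legendreA]
  have split : ∀ n : ℕ, ∑ i, (e i : ℂ) * pdC (zonalA e (n + 1)) i y =
      zonalA e n y + (∑ i, (e i : ℂ) * y i) * ∑ i, (e i : ℂ) * pdC (zonalA e n) i y +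
        (n + 1) * ∑ i, (e i : ℂ) * pdC (zonalG e n) i y := by
    intro n
    calc _ = ∑ i, ((e i : ℂ) * e i * zonalA e n y + (∑ i, (e i : ℂ) * y i) *
          ((e i : ℂ) * pdC (zonalA e n) i y) + (n + 1) * ((e i : ℂ) * pdC (zonalG e n) i y)) :=
        Finset.sum_congr rfl fun i _ => by rw [pdC_zonalA_succ e n i hy]; ring
      _ = _ := by
        rw [Finset.sum_add_distrib, Finset.sum_add_distrib, ← Finset.sum_mul, he, one_mul,
          Finset.mul_sum, Finset.mul_sum]
  induction n with
  | zero =>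
    rw [split 0]
    simp [funext h1, pdC_const, pdC_zonalG_zero]
  | succ n ih =>
    rw [split (n + 1), ih, sum_pdC_zonalG e he n hy, zonalA_succ]
    push_cast
    ring

lemma isSolid_zonalG (e : E3) (he : ∑ i, (e i : ℂ) * e i = 1) (n : ℕ) :
    IsSolid n (zonalG e n) := by
  refine ⟨smoothOff_zonalG e n, isHomog_zonalG e n, fun y hy => ?_⟩
  cases n with
  | zero => simp [lapC, funext (pdC_zonalG_zero e _), pdC_const]
  | succ n =>
    have h : ∀ i, pdC (pdC (zonalG e (n + 1)) i) i y = e i * pdC (zonalA e (n + 1)) i y -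
        (zonalA e n y + y i * pdC (zonalA e n) i y) := by
      intro i
      rw [pdC_congr (fun w hw => pdC_zonalG_succ e n i hw) hy,
        pdC_sub ((SmoothOff.const _).mul (smoothOff_zonalA e _))
          ((SmoothOff.coord i).mul (smoothOff_zonalA e _)) hy,
        pdC_const_mul _ (smoothOff_zonalA e _) hy,
        pdC_mul (SmoothOff.coord i) (smoothOff_zonalA e _) hy, pdC_coord]
      simp
    rw [lapC, Finset.sum_congr rfl fun i _ => h i, Finset.sum_sub_distrib,
      Finset.sum_add_distrib, sum_pdC_zonalA e he n hy,
      (isHomog_zonalA e n).euler (smoothOff_zonalA e n) hy]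
    simp
    ring

lemma sum_mul_self_of_norm_eq_one {e : E3} (he : ‖e‖ = 1) : ∑ i, (e i : ℂ) * e i = 1 := by
  have := EuclideanSpace.norm_sq_eq e
  rw [he, ← Complex.ofReal_inj] at this
  simpa [← pow_two] using this.symm

lemma norm_sphere (v : Metric.sphere (0 : E3) 1) : ‖(v : E3)‖ = 1 := by simp

lemma zonalG_self {e : E3} (he : ‖e‖ = 1) (n : ℕ) : zonalG e n e = 1 := by
  have := EuclideanSpace.norm_sq_eq e
  rw [he] at this
  simp only [Real.norm_eq_abs, sq_abs, one_pow] at this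
  simp [zonalG, ← pow_two, ← this, legendreG_one_one]

lemma integral_mul_directional_zonalG_eq_zero {n : ℕ} {F : E3 → ℂ} (hF : IsSolid (n + 1) F)
    {e : E3} (he : ‖e‖ = 1) :
    ∫ v : Metric.sphere (0 : E3) 1, F v * ∑ i, (e i : ℂ) * pdC (zonalG e n) i v
      ∂sphereMeasure = 0 := by
  have he' := sum_mul_self_of_norm_eq_one he
  cases n with
  | zero => simp [pdC_zonalG_zero]
  | succ k =>
    simp only [sum_pdC_zonalG e he' k (sphere_ne_zero _), mul_left_comm (F _)]
    rw [integral_const_mul, hF.integral_mul_eq_zero (isSolid_zonalG e he' k)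
      (by push_cast; omega) (by push_cast; omega), mul_zero]

lemma integral_mul_linear_mul_zonalG {n : ℕ} {F : E3 → ℂ} (hF : IsSolid (n + 1) F)
    {e : E3} (he : ‖e‖ = 1) :
    (2 * n + 1) * ∫ v : Metric.sphere (0 : E3) 1,
        (∑ i, (e i : ℂ) * v.1 i) * (F v * zonalG e n v) ∂sphereMeasure =
      (n + 1) * ∫ v : Metric.sphere (0 : E3) 1, F v * zonalG e (n + 1) v ∂sphereMeasure := by
  have he' := sum_mul_self_of_norm_eq_one he
  cases n with
  | zero =>
    simp [zonalG, legendreG, mul_comm]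
  | succ k =>
    have h0 := hF.integral_mul_eq_zero (isSolid_zonalG e he' k)
      (by push_cast; omega) (by push_cast; omega)
    have hk : ((k : ℂ) + 2) ≠ 0 := by exact_mod_cast (Nat.succ_ne_zero (k + 1))
    have hk' : (2 * (k : ℂ) + 3) ≠ 0 := by exact_mod_cast (Nat.succ_ne_zero (2 * k + 2))
    have h1 : ∀ v : Metric.sphere (0 : E3) 1,
        (∑ i, (e i : ℂ) * v.1 i) * (F v * zonalG e (k + 1) v) =
        (k + 2) / (2 * k + 3) * (F v * zonalG e (k + 2) v) +
          (k + 1) / (2 * k + 3) * (F v * zonalG e k v) := by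
      intro v
      have i1 := mul_inv_cancel₀ hk
      have i2 := mul_inv_cancel₀ hk'
      rw [zonalG_add_two, sum_mul_self_of_norm_eq_one (norm_sphere v)]
      simp only [div_eq_mul_inv]
      set S := (∑ i, (e i : ℂ) * v.1 i) * (F v * zonalG e (k + 1) v)
      linear_combination -(S * ((2 * k + 3) * (2 * (k : ℂ) + 3)⁻¹) -
        (k + 1) * (2 * (k : ℂ) + 3)⁻¹ * (F v * zonalG e k v)) * i1 - S * i2
    simp only [h1]
    rw [integral_add, integral_const_mul, integral_const_mul, h0]
    · push_cast
      field_simp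
      ring
    · exact (hF.smooth.mul (smoothOff_zonalG e _)).integrable.const_mul _
    · exact (hF.smooth.mul (smoothOff_zonalG e _)).integrable.const_mul _

/-- The zonal harmonic reproduces solid harmonics of the same degree. -/
theorem IsSolid.integral_mul_zonalG {n : ℕ} {F : E3 → ℂ} (hF : IsSolid n F) {e : E3}
    (he : ‖e‖ = 1) :
    (2 * n + 1) * ∫ v : Metric.sphere (0 : E3) 1, F v * zonalG e n v ∂sphereMeasure =
      4 * π * F e := by
  have he' := sum_mul_self_of_norm_eq_one he
  have he0 : e ≠ 0 := by rintro rfl; simp at he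
  induction n generalizing F with
  | zero =>
    have h : ∀ v : Metric.sphere (0 : E3) 1, F v * zonalG e 0 v = F e := fun v => by
      rw [hF.eq_of_degree_zero (sphere_ne_zero v) he0]
      simp [zonalG, legendreG]
    simp only [h]
    simp [sphereMeasure_real_univ]
  | succ n ih =>
    push_cast at hF
    have hE : IsSolid n (fun y => ∑ i, (e i : ℂ) * _root_.pdC F i y) :=
      IsSolid.sum fun i _ => by simpa using (hF.pdC i).const_mul (e i : ℂ)
    have h1 := ih hE
    rw [hF.homog.euler hF.smooth he0] at h1
    have hs : SmoothOff (fun y => F y * zonalG e n y) := hF.smooth.mul (smoothOff_zonalG e n)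
    have hd : IsHomog (2 * n + 1) (fun y => F y * zonalG e n y) := by
      convert hF.homog.mul (isHomog_zonalG e n) using 1; ring
    have h2 := integral_sphere_sum_pdC (h := fun i y => (e i : ℂ) * (F y * zonalG e n y))
      (fun i => hd.const_mul _) (fun i => (SmoothOff.const _).mul hs)
    have h3 : ∀ v : Metric.sphere (0 : E3) 1,
        ∑ i, _root_.pdC (fun y => (e i : ℂ) * (F y * zonalG e n y)) i v =
        (∑ i, (e i : ℂ) * _root_.pdC F i v) * zonalG e n v +
          F v * ∑ i, (e i : ℂ) * _root_.pdC (zonalG e n) i v := by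
      intro v
      rw [Finset.sum_mul, Finset.mul_sum, ← Finset.sum_add_distrib]
      refine Finset.sum_congr rfl fun i _ => ?_
      rw [pdC_const_mul _ hs (sphere_ne_zero v),
        pdC_mul hF.smooth (smoothOff_zonalG e n) (sphere_ne_zero v)]
      ring
    have h4 : ∀ v : Metric.sphere (0 : E3) 1,
        ∑ i, (v.1 i : ℂ) * ((e i : ℂ) * (F v * zonalG e n v)) =
        (∑ i, (e i : ℂ) * v.1 i) * (F v * zonalG e n v) := by
      intro v
      rw [Finset.sum_mul]
      exact Finset.sum_congr rfl fun i _ => by ring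
    simp only [h3, h4] at h2
    rw [integral_add, integral_mul_directional_zonalG_eq_zero hF he] at h2
    · have h5 := integral_mul_linear_mul_zonalG hF he
      have hn : ((n : ℂ) + 1) ≠ 0 := by exact_mod_cast (Nat.succ_ne_zero n)
      apply mul_left_cancel₀ hn
      push_cast at *
      linear_combination h1 - (2 * n + 1) * h2 - (2 * n + 3) * h5
    · exact (hE.smooth.mul (smoothOff_zonalG e n)).integrable
    · exact (hF.smooth.mul (SmoothOff.sum fun i _ =>
        (SmoothOff.const _).mul ((smoothOff_zonalG e n).pdC i))).integrable

lemma conj_zonalG (e : E3) (n : ℕ) (y : E3) : (starRingEnd ℂ) (zonalG e n y) = zonalG e n y := by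
  simp [zonalG]

/-- The difference between the two sides of the addition theorem. -/
noncomputable def additionDefect {ι : Type*} (s : Finset ι) (Y : ι → E3 → ℂ) (n : ℕ) (x y : E3) :
    ℂ :=
  (2 * n + 1) / (4 * π) * zonalG x n y - ∑ j ∈ s, (starRingEnd ℂ) (Y j x) * Y j y

section Addition

variable {ι : Type*} {s : Finset ι} {Y : ι → E3 → ℂ} {n : ℕ}

lemma isSolid_additionDefect (hY : ∀ j ∈ s, IsSolid n (Y j)) {x : E3} (hx : ‖x‖ = 1) :
    IsSolid n (additionDefect s Y n x) :=
  ((isSolid_zonalG x (sum_mul_self_of_norm_eq_one hx) n).const_mul _).sub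
    (IsSolid.sum fun j hj => (hY j hj).const_mul _)

lemma integral_additionDefect_mul_conj [DecidableEq ι] (hY : ∀ j ∈ s, IsSolid n (Y j))
    (horth : ∀ j ∈ s, ∀ k ∈ s, ∫ v : Metric.sphere (0 : E3) 1,
      Y j v * (starRingEnd ℂ) (Y k v) ∂sphereMeasure = if j = k then 1 else 0)
    {x : E3} (hx : ‖x‖ = 1) {k : ι} (hk : k ∈ s) :
    ∫ v : Metric.sphere (0 : E3) 1, additionDefect s Y n x v * (starRingEnd ℂ) (Y k v)
      ∂sphereMeasure = 0 := by
  have h1 := (hY k hk).conj.integral_mul_zonalG hx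
  have hs : SmoothOff fun y => (starRingEnd ℂ) (Y k y) := (hY k hk).smooth.conj
  have hi : ∀ j ∈ s, Integrable (fun v : Metric.sphere (0 : E3) 1 =>
      (starRingEnd ℂ) (Y j x) * (Y j v * (starRingEnd ℂ) (Y k v))) sphereMeasure :=
    fun j hj => ((hY j hj).smooth.mul hs).integrable.const_mul _
  have h2 : ∀ v : Metric.sphere (0 : E3) 1,
      additionDefect s Y n x v * (starRingEnd ℂ) (Y k v) =
      (2 * n + 1) / (4 * π) * ((starRingEnd ℂ) (Y k v) * zonalG x n v) -
        ∑ j ∈ s, (starRingEnd ℂ) (Y j x) * (Y j v * (starRingEnd ℂ) (Y k v)) := by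
    intro v
    rw [additionDefect, sub_mul, Finset.sum_mul]
    congr 1
    · ring
    · exact Finset.sum_congr rfl fun j _ => by ring
  simp only [h2]
  rw [integral_sub ((hs.mul (smoothOff_zonalG x n)).integrable.const_mul _)
    (integrable_finsetSum _ hi), integral_const_mul, integral_finsetSum _ hi]
  simp only [integral_const_mul]
  rw [Finset.sum_congr rfl fun j hj => by rw [horth j hj k hk], div_mul_eq_mul_div, h1]
  simp [hk]

lemma integral_conj_additionDefect_mul [DecidableEq ι] (hY : ∀ j ∈ s, IsSolid n (Y j))
    (horth : ∀ j ∈ s, ∀ k ∈ s, ∫ v : Metric.sphere (0 : E3) 1,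
      Y j v * (starRingEnd ℂ) (Y k v) ∂sphereMeasure = if j = k then 1 else 0)
    {x : E3} (hx : ‖x‖ = 1) :
    ∫ v : Metric.sphere (0 : E3) 1, (starRingEnd ℂ) (additionDefect s Y n x v) *
      additionDefect s Y n x v ∂sphereMeasure = additionDefect s Y n x x := by
  have hD := isSolid_additionDefect hY hx
  have h1 := hD.integral_mul_zonalG hx
  have hi : ∀ j ∈ s, Integrable (fun v : Metric.sphere (0 : E3) 1 =>
      Y j x * (additionDefect s Y n x v * (starRingEnd ℂ) (Y j v))) sphereMeasure :=
    fun j hj => (hD.smooth.mul (hY j hj).smooth.conj).integrable.const_mul _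
  have h2 : ∀ v : Metric.sphere (0 : E3) 1,
      (starRingEnd ℂ) (additionDefect s Y n x v) * additionDefect s Y n x v =
      (2 * n + 1) / (4 * π) * (additionDefect s Y n x v * zonalG x n v) -
        ∑ j ∈ s, Y j x * (additionDefect s Y n x v * (starRingEnd ℂ) (Y j v)) := by
    intro v
    have : (starRingEnd ℂ) (additionDefect s Y n x v) =
        (2 * n + 1) / (4 * π) * zonalG x n v - ∑ j ∈ s, Y j x * (starRingEnd ℂ) (Y j v) := by
      simp [additionDefect, conj_zonalG, Complex.conj_ofReal, map_ofNat]
    rw [this, sub_mul, Finset.sum_mul]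
    congr 1
    · ring
    · exact Finset.sum_congr rfl fun j _ => by ring
  simp only [h2]
  rw [integral_sub ((hD.smooth.mul (smoothOff_zonalG x n)).integrable.const_mul _)
    (integrable_finsetSum _ hi), integral_const_mul, integral_finsetSum _ hi]
  simp only [integral_const_mul]
  rw [Finset.sum_eq_zero fun j hj => by
    rw [integral_additionDefect_mul_conj hY horth hx hj, mul_zero], div_mul_eq_mul_div, h1]
  have hpi : (π : ℂ) ≠ 0 := by exact_mod_cast pi_ne_zero
  field_simp
  simp

/-- The addition theorem for an orthonormal family of `2 * n + 1` spherical harmonics. -/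
theorem sum_conj_mul_eq_zonalG [DecidableEq ι] (hY : ∀ j ∈ s, IsSolid n (Y j))
    (horth : ∀ j ∈ s, ∀ k ∈ s, ∫ v : Metric.sphere (0 : E3) 1,
      Y j v * (starRingEnd ℂ) (Y k v) ∂sphereMeasure = if j = k then 1 else 0)
    (hcard : s.card = 2 * n + 1) {x y : E3} (hx : ‖x‖ = 1) (hy : ‖y‖ = 1) :
    ∑ j ∈ s, (starRingEnd ℂ) (Y j x) * Y j y = (2 * n + 1) / (4 * π) * zonalG x n y := by
  have hpi : (π : ℂ) ≠ 0 := by exact_mod_cast pi_ne_zero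
  let D : Metric.sphere (0 : E3) 1 → ℝ := fun v => (2 * n + 1) / (4 * π) - ∑ j ∈ s, ‖Y j v‖ ^ 2
  have hDeq : ∀ v : Metric.sphere (0 : E3) 1, additionDefect s Y n v v = D v := by
    intro v
    simp only [additionDefect, zonalG_self (norm_sphere v), D, mul_one]
    push_cast
    congr 1
    exact Finset.sum_congr rfl fun j _ => by rw [mul_comm, Complex.mul_conj']
  have hpos : ∀ v, 0 ≤ D v := by
    intro v
    have h1 := integral_conj_additionDefect_mul hY horth (norm_sphere v)
    rw [hDeq] at h1
    simp only [Complex.conj_mul', ← Complex.ofReal_pow] at h1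
    rw [integral_complex_ofReal, Complex.ofReal_inj] at h1
    rw [← h1]
    positivity
  have hcont : Continuous D := continuous_const.sub
    (continuous_finsetSum _ fun j hj => ((hY j hj).smooth.continuous_sphere.norm).pow 2)
  have hint : ∫ v, D v ∂sphereMeasure = 0 := by
    have h2 : ∀ j ∈ s, ∫ v : Metric.sphere (0 : E3) 1, ‖Y j v‖ ^ 2 ∂sphereMeasure = 1 := by
      intro j hj
      have := horth j hj j hj
      simp only [Complex.mul_conj', ← Complex.ofReal_pow] at this
      rw [integral_complex_ofReal] at this
      simpa using this
    have hi : ∀ j ∈ s, Integrable (fun v : Metric.sphere (0 : E3) 1 => ‖Y j v‖ ^ 2)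
        sphereMeasure := fun j hj => ((hY j hj).smooth.continuous_sphere.norm.pow
      2).integrable_of_hasCompactSupport (HasCompactSupport.of_compactSpace _)
    simp only [D]
    rw [integral_sub (integrable_const _) (integrable_finsetSum _ hi), integral_finsetSum _ hi,
      Finset.sum_congr rfl h2]
    simp [sphereMeasure_real_univ, hcard]
    field_simp
    simp
  have hae := (integral_eq_zero_iff_of_nonneg hpos
    (hcont.integrable_of_hasCompactSupport (HasCompactSupport.of_compactSpace _))).mp hint
  have hzero := congrFun ((Continuous.ae_eq_iff_eq sphereMeasure hcont continuous_const).mp hae)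
    ⟨x, by simpa using hx⟩
  have h3 := integral_conj_additionDefect_mul hY horth hx
  have h4 := hDeq ⟨x, by simpa using hx⟩
  rw [hzero] at h4
  simp only at h4
  rw [h4] at h3
  have h5 := eq_zero_of_integral_sphere_norm_sq (s := {()})
    (f := fun _ : Unit => additionDefect s Y n x)
    (fun _ _ => (isSolid_additionDefect hY hx).smooth) (by simpa using! h3)
    ⟨y, by simpa using hy⟩ () (by simp)
  simp only [additionDefect] at h5
  exact (sub_eq_zero.mp h5).symm

end Addition

lemma norm_zonalG_le_one_of_addition {ι : Type*} {s : Finset ι} {Y : ι → E3 → ℂ} {n : ℕ}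
    (h : ∀ x y : E3, ‖x‖ = 1 → ‖y‖ = 1 →
      ∑ j ∈ s, (starRingEnd ℂ) (Y j x) * Y j y = (2 * n + 1) / (4 * π) * zonalG x n y)
    {x y : E3} (hx : ‖x‖ = 1) (hy : ‖y‖ = 1) : ‖zonalG x n y‖ ≤ 1 := by
  have hself : ∀ w : E3, ‖w‖ = 1 → ∑ j ∈ s, ‖Y j w‖ ^ 2 = (2 * n + 1) / (4 * π) := by
    intro w hw
    have := h w w hw hw
    simp only [zonalG_self hw, Complex.conj_mul', mul_one] at this
    exact_mod_cast this
  have hp : (0 : ℝ) < (2 * n + 1) / (4 * π) := by positivity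
  have h1 : (2 * n + 1) / (4 * π) * ‖zonalG x n y‖ =
      ‖∑ j ∈ s, (starRingEnd ℂ) (Y j x) * Y j y‖ := by
    rw [h x y hx hy, norm_mul]
    congr 1
    have : ((2 * n + 1) / (4 * π) : ℂ) = (((2 * n + 1) / (4 * π) : ℝ) : ℂ) := by push_cast; rfl
    rw [this, Complex.norm_real, Real.norm_of_nonneg hp.le]
  have h2 : ‖∑ j ∈ s, (starRingEnd ℂ) (Y j x) * Y j y‖ ≤
      ∑ j ∈ s, (‖Y j x‖ ^ 2 + ‖Y j y‖ ^ 2) / 2 := by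
    refine (norm_sum_le _ _).trans (Finset.sum_le_sum fun j _ => ?_)
    rw [norm_mul, Complex.norm_conj]
    nlinarith [sq_nonneg (‖Y j x‖ - ‖Y j y‖)]
  rw [← Finset.sum_div, Finset.sum_add_distrib, hself x hx, hself y hy, ← h1] at h2
  nlinarith

lemma hasSum_mul_pow_of_succ {a : ℕ → ℝ} {ρ P : ℝ} (h0 : a 0 = 0)
    (h : HasSum (fun n => a (n + 1) * ρ ^ n) P) : HasSum (fun n => a n * ρ ^ n) (ρ * P) := by
  have h1 : HasSum (fun n => a (n + 1) * ρ ^ (n + 1)) (ρ * P) :=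
    (h.mul_left ρ).congr_fun fun n => by ring
  simpa [h0] using (hasSum_nat_add_iff (f := fun n => a n * ρ ^ n) 1).mp h1

lemma hasSum_succ_mul_pow {a : ℕ → ℝ} {ρ P : ℝ} (h : HasSum (fun n => a n * ρ ^ n) P) :
    HasSum (fun n => a (n + 1) * ρ ^ (n + 1)) (P - a 0) := by
  simpa using (hasSum_nat_add_iff' (f := fun n => a n * ρ ^ n) 1).mpr h

lemma one_sub_two_mul_add_sq_pos {t ρ : ℝ} (ht : |t| ≤ 1) (hρ : |ρ| < 1) :
    0 < 1 - 2 * t * ρ + ρ ^ 2 := by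
  have h1 : t * ρ ≤ |ρ| := by
    calc t * ρ ≤ |t * ρ| := le_abs_self _
      _ = |t| * |ρ| := abs_mul _ _
      _ ≤ 1 * |ρ| := by gcongr
      _ = |ρ| := one_mul _
  have h2 := sq_abs ρ
  nlinarith

lemma summable_legendreG {t : ℝ} (hG : ∀ n, |legendreG n t 1| ≤ 1) {ρ : ℝ} (hρ : |ρ| < 1) :
    Summable fun n => legendreG n t 1 * ρ ^ n := by
  refine Summable.of_norm_bounded (summable_geometric_of_lt_one (abs_nonneg ρ) hρ) fun n => ?_
  rw [norm_mul, norm_pow, Real.norm_eq_abs, Real.norm_eq_abs]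
  exact mul_le_of_le_one_left (by positivity) (hG n)

lemma abs_legendreA_le {t : ℝ} (hG : ∀ n, |legendreG n t 1| ≤ 1) (n : ℕ) :
    |legendreA n t 1| ≤ n ^ 2 := by
  have ht : |t| ≤ 1 := hG 1
  induction n with
  | zero => simp [legendreA]
  | succ n ih =>
    rw [legendreA_succ]
    have h1 : |t * legendreA n t 1| ≤ n ^ 2 := by
      rw [abs_mul]
      exact (mul_le_of_le_one_left (abs_nonneg _) ht).trans ih
    have h2 : |((n : ℝ) + 1) * legendreG n t 1| ≤ n + 1 := by
      rw [abs_mul, abs_of_nonneg (by positivity)]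
      exact mul_le_of_le_one_right (by positivity) (hG n)
    have h3 := abs_add_le (t * legendreA n t 1) (((n : ℝ) + 1) * legendreG n t 1)
    have h4 : (0 : ℝ) ≤ n := Nat.cast_nonneg n
    push_cast
    nlinarith

lemma summable_legendreA {t : ℝ} (hG : ∀ n, |legendreG n t 1| ≤ 1) {ρ : ℝ} (hρ : |ρ| < 1) :
    Summable fun n => legendreA n t 1 * ρ ^ n := by
  have h1 : Summable fun n : ℕ => (n : ℝ) ^ 2 * |ρ| ^ n :=
    summable_pow_mul_geometric_of_norm_lt_one 2 (by simpa using hρ)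
  refine Summable.of_norm_bounded h1 fun n => ?_
  rw [norm_mul, norm_pow, Real.norm_eq_abs, Real.norm_eq_abs]
  gcongr
  exact abs_legendreA_le hG n

lemma hasDerivAt_tsum_legendreG {t : ℝ} (hG : ∀ n, |legendreG n t 1| ≤ 1) {ρ : ℝ}
    (hρ : |ρ| < 1) : ∃ P, HasSum (fun n : ℕ => ((n + 1 : ℕ) * legendreG (n + 1) t 1) * ρ ^ n) P ∧
      HasDerivAt (fun r : ℝ => ∑' n, legendreG n t 1 * r ^ n) P ρ := by
  obtain ⟨r, hr, hr1⟩ := exists_between hρ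
  have hr0 : 0 < r := (abs_nonneg ρ).trans_lt hr
  have hu : Summable fun n : ℕ => (n : ℝ) * r ^ (n - 1) := by
    rw [← summable_nat_add_iff 1]
    have h1 := summable_pow_mul_geometric_of_norm_lt_one (R := ℝ) 1
      (r := r) (by rwa [Real.norm_eq_abs, abs_of_pos hr0])
    have h2 := summable_geometric_of_lt_one hr0.le hr1
    refine (h1.add h2).congr fun n => ?_
    push_cast
    simp
    ring
  have hbd : ∀ (n : ℕ), ∀ y ∈ Metric.ball (0 : ℝ) r,
      ‖legendreG n t 1 * (n * y ^ (n - 1))‖ ≤ n * r ^ (n - 1) := by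
    intro n y hy
    have hy' : |y| ≤ r := by simpa using (mem_ball_zero_iff.mp hy).le
    rw [norm_mul, norm_mul, norm_pow, Real.norm_eq_abs, Real.norm_eq_abs, Real.norm_eq_abs,
      abs_of_nonneg (Nat.cast_nonneg n : (0 : ℝ) ≤ n)]
    calc _ ≤ 1 * (n * |y| ^ (n - 1)) := by gcongr; exact hG n
      _ ≤ _ := by rw [one_mul]; gcongr
  have hmem : ρ ∈ Metric.ball (0 : ℝ) r := by simpa using hr
  have h := hasDerivAt_tsum_of_isPreconnected hu Metric.isOpen_ball
    (convex_ball (0 : ℝ) r).isPreconnected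
    (fun n y _ => (hasDerivAt_pow n y).const_mul (legendreG n t 1)) hbd hmem
    (summable_legendreG hG hρ) hmem
  refine ⟨_, ?_, h⟩
  have hs := (Summable.of_norm_bounded hu fun n => hbd n ρ hmem).hasSum
  have := (hasSum_nat_add_iff' 1).mpr hs
  simp only [Finset.range_one, Finset.sum_singleton, Nat.cast_zero, zero_mul, mul_zero,
    sub_zero] at this
  refine this.congr_fun fun n => ?_
  rw [Nat.add_sub_cancel]
  ring

/-- The generating function of the Legendre polynomials. -/
theorem hasSum_legendreG {t : ℝ} (hG : ∀ n, |legendreG n t 1| ≤ 1) {ρ : ℝ} (hρ : |ρ| < 1) :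
    HasSum (fun n => legendreG n t 1 * ρ ^ n) (√(1 - 2 * t * ρ + ρ ^ 2))⁻¹ := by
  have ht : |t| ≤ 1 := hG 1
  set F : ℝ → ℝ := fun r => ∑' n, legendreG n t 1 * r ^ n with hF
  set W : ℝ → ℝ := fun r => F r * √(1 - 2 * t * r + r ^ 2) with hW
  have hd : ∀ r ∈ Set.Ioo (-1 : ℝ) 1, HasDerivAt W 0 r := by
    intro r hr
    have hr' : |r| < 1 := abs_lt.mpr hr
    have hD := one_sub_two_mul_add_sq_pos ht hr'
    obtain ⟨P, hP, hFP⟩ := hasDerivAt_tsum_legendreG hG hr'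
    have hode : P * (1 - 2 * t * r + r ^ 2) = (t - r) * F r := by
      have s1 : HasSum (fun n => legendreG n t 1 * r ^ n) (F r) :=
        (summable_legendreG hG hr').hasSum
      have s2 := hasSum_mul_pow_of_succ (a := fun n => (n : ℝ) * legendreG n t 1) (by simp) hP
      have s3 := hasSum_succ_mul_pow s1
      have s4 := hasSum_succ_mul_pow s2
      have s5 := hasSum_succ_mul_pow
        (a := fun n => ((n + 1 : ℕ) : ℝ) * legendreG (n + 1) t 1) hP
      have s6 := (((s4.mul_left (2 * t)).add (s3.mul_left t)).sub (s2.mul_left r)).sub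
        (s1.mul_left r)
      have s7 := s5.unique (s6.congr_fun ?_)
      · simp [legendreG] at s7
        linear_combination s7
      · intro n
        have := legendreG_add_two n t 1
        push_cast
        linear_combination r ^ (n + 1) * this
    have hDd : HasDerivAt (fun r : ℝ => 1 - 2 * t * r + r ^ 2) (2 * (r - t)) r := by
      refine ((((hasDerivAt_id r).const_mul (2 * t)).const_sub 1).add
        (hasDerivAt_pow 2 r)).congr_deriv ?_
      norm_num
      ring
    refine (hFP.mul (hDd.sqrt hD.ne')).congr_deriv ?_
    change P * √(1 - 2 * t * r + r ^ 2) + F r * _ = 0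
    have hsq := Real.sq_sqrt hD.le
    have hs0 := (Real.sqrt_pos.mpr hD).ne'
    field_simp
    rw [hsq]
    linear_combination hode
  have hρ' : ρ ∈ Set.Ioo (-1 : ℝ) 1 := abs_lt.mp hρ
  have h0 : (0 : ℝ) ∈ Set.Ioo (-1 : ℝ) 1 := by constructor <;> norm_num
  have hconst : W ρ = W 0 := isOpen_Ioo.is_const_of_deriv_eq_zero isPreconnected_Ioo
    (fun r hr => (hd r hr).differentiableAt.differentiableWithinAt)
    (fun r hr => (hd r hr).deriv) hρ' h0
  have hF0 : F 0 = 1 := by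
    rw [hF]
    simp only
    rw [tsum_eq_single 0 fun n hn => by simp [hn]]
    simp [legendreG]
  have hs0 := (Real.sqrt_pos.mpr (one_sub_two_mul_add_sq_pos ht hρ)).ne'
  have hval : F ρ = (√(1 - 2 * t * ρ + ρ ^ 2))⁻¹ := by
    refine eq_inv_of_mul_eq_one_left ?_
    simpa [hW, hF0] using hconst
  rw [← hval]
  exact (summable_legendreG hG hρ).hasSum

theorem hasSum_legendreA_succ {t : ℝ} (hG : ∀ n, |legendreG n t 1| ≤ 1) {ρ : ℝ}
    (hρ : |ρ| < 1) (hρ0 : ρ ≠ 0) :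
    HasSum (fun n => legendreA (n + 1) t 1 * ρ ^ n)
      ((1 - 2 * t * ρ + ρ ^ 2) * √(1 - 2 * t * ρ + ρ ^ 2))⁻¹ := by
  have hD := one_sub_two_mul_add_sq_pos (t := t) (hG 1) hρ
  have s0 : Summable fun n => legendreA (n + 1) t 1 * ρ ^ n := by
    have h := (hasSum_succ_mul_pow (summable_legendreA hG hρ).hasSum).summable.mul_left ρ⁻¹
    refine h.congr fun n => ?_
    rw [pow_succ]
    field_simp
  obtain ⟨Q, hQ⟩ := s0
  have hG1 := hasSum_succ_mul_pow (hasSum_legendreG hG hρ)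
  have s2 := hasSum_mul_pow_of_succ (a := fun n => legendreA n t 1) (by simp [legendreA]) hQ
  have s3 := hasSum_succ_mul_pow (a := fun n => legendreA (n + 1) t 1) hQ
  have s4 := ((hQ.mul_left (2 * t * ρ)).add hG1).sub (s2.mul_left ρ)
  have s5 := s3.unique (s4.congr_fun ?_)
  · simp [legendreA, legendreG] at s5
    have : Q = ((1 - 2 * t * ρ + ρ ^ 2) * √(1 - 2 * t * ρ + ρ ^ 2))⁻¹ := by
      rw [mul_inv]
      apply mul_left_cancel₀ hD.ne'
      rw [mul_inv_cancel_left₀ hD.ne']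
      linear_combination s5
    rwa [← this]
  · intro n
    have h1 := mul_legendreA_succ_sub n t 1
    have h2 := legendreA_succ (n + 1) t 1
    push_cast at h2
    linear_combination ρ ^ (n + 1) * (h2 - h1)

lemma fderiv_Gamma0 {w : E3} (hw : w ≠ 0) (i : Fin 3) :
    fderiv ℝ Gamma0 w (EuclideanSpace.single i 1) = w i / (4 * π * ‖w‖ ^ 3) := by
  have hn : ‖w‖ ≠ 0 := norm_ne_zero_iff.mpr hw
  have h : HasFDerivAt Gamma0 _ w :=
    HasFDerivAt.const_mul ((hasDerivAt_inv (mul_ne_zero (by positivity : 4 * π ≠ 0)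
      hn)).comp_hasFDerivAt w ((hasFDerivAt_norm_of_ne_zero hw).const_mul (4 * π))) (-1)
  rw [h.fderiv]
  simp [EuclideanSpace.inner_single_right]
  field_simp

lemma smoothOff_norm_pow (n : ℕ) : SmoothOff (fun y : E3 => (‖y‖ : ℂ) ^ n) := fun y hy =>
  ((Complex.ofRealCLM.contDiff.contDiffAt.comp y (contDiffAt_norm ℝ hy)).pow n).contDiffWithinAt

lemma pdC_norm_pow (n : ℕ) (i : Fin 3) {y : E3} (hy : ‖y‖ = 1) :
    pdC (fun y : E3 => (‖y‖ : ℂ) ^ n) i y = n * y i := by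
  have hy0 : y ≠ 0 := by rintro rfl; simp at hy
  have h := (Complex.ofRealCLM.hasFDerivAt.comp y (hasFDerivAt_norm_of_ne_zero hy0)).pow n
  have h' : HasFDerivAt (fun y : E3 => (‖y‖ : ℂ) ^ n) _ y := h
  rw [pdC, h'.fderiv]
  simp [hy, EuclideanSpace.inner_single_right]

lemma IsHomog.norm_pow_mul_unitize (n : ℕ) (f : E3 → ℂ) :
    IsHomog n (fun y => (‖y‖ : ℂ) ^ n * f (unitize y)) := by
  intro c hc y hy
  have : unitize (c • y) = unitize y := by
    simp only [unitize, norm_smul, Real.norm_of_nonneg hc.le, smul_smul]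
    congr 1
    field_simp
  simp only [this, norm_smul, Real.norm_of_nonneg hc.le]
  push_cast
  rw [mul_pow, zpow_natCast, mul_assoc]

lemma surfGrad_eq {f : E3 → ℂ} (hf : SmoothOff fun y => f (unitize y)) (n : ℕ) {x : E3}
    (hx : ‖x‖ = 1) (i : Fin 3) : surfGrad f x i =
      pdC (fun y => (‖y‖ : ℂ) ^ n * f (unitize y)) i x - n * x i * f x := by
  have hx0 : x ≠ 0 := by rintro rfl; simp at hx
  rw [pdC_mul (smoothOff_norm_pow n) hf hx0, pdC_norm_pow n i hx, hx, unitize_of_norm_eq_one hx,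
    surfGrad, pdC]
  simp

lemma zonalA_of_norm_eq_one (e : E3) (n : ℕ) {y : E3} (hy : ‖y‖ = 1) :
    zonalA e n y = legendreA n (∑ i, e i * y i) 1 := by
  have := EuclideanSpace.norm_sq_eq y
  rw [hy] at this
  simp only [Real.norm_eq_abs, sq_abs, one_pow] at this
  rw [zonalA, ← this]

lemma zonalG_of_norm_eq_one (e : E3) (n : ℕ) {y : E3} (hy : ‖y‖ = 1) :
    zonalG e n y = legendreG n (∑ i, e i * y i) 1 := by
  have := EuclideanSpace.norm_sq_eq y
  rw [hy] at this
  simp only [Real.norm_eq_abs, sq_abs, one_pow] at this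
  rw [zonalG, ← this]

lemma mul_zonalG_sub_pdC (e : E3) (n : ℕ) (i : Fin 3) {y : E3} (hy : ‖y‖ = 1) :
    (2 * n + 1) * y i * zonalG e n y - pdC (zonalG e n) i y =
      y i * zonalA e (n + 1) y - e i * zonalA e n y := by
  have hy0 : y ≠ 0 := by rintro rfl; simp at hy
  cases n with
  | zero =>
    rw [pdC_zonalG_zero, zonalA_succ]
    simp [zonalG, zonalA, legendreG, legendreA]
  | succ n =>
    have h1 := mul_zonalA_succ_sub e n y
    rw [sum_mul_self_of_norm_eq_one hy] at h1
    rw [pdC_zonalG_succ e n i hy0, zonalA_succ e (n + 1)]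
    push_cast
    linear_combination -(y i : ℂ) * h1

lemma smul_unitize {y : E3} (hy : y ≠ 0) : ‖y‖ • unitize y = y := by
  rw [unitize, smul_smul, mul_inv_cancel₀ (norm_ne_zero_iff.mpr hy), one_smul]

lemma norm_smul_sub_smul {e f : E3} (he : ‖e‖ = 1) (hf : ‖f‖ = 1) {R ρ : ℝ} (hR : 0 < R) :
    ‖R • e - (R * ρ) • f‖ = R * √(1 - 2 * (∑ i, f i * e i) * ρ + ρ ^ 2) := by
  have h1 : ‖R • e - (R * ρ) • f‖ = R * ‖e - ρ • f‖ := by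
    rw [mul_smul, ← smul_sub, norm_smul, Real.norm_of_nonneg hR.le]
  have h2 : inner ℝ e f = ∑ i, f i * e i := by simp [PiLp.inner_apply]
  rw [h1, ← Real.sqrt_sq (norm_nonneg (e - ρ • f)), norm_sub_sq_real, he, norm_smul, hf,
    inner_smul_right, h2, Real.norm_eq_abs, mul_one, sq_abs]
  ring_nf

lemma hasSum_zonal_fderiv_Gamma0 {z x : E3} {R : ℝ} (hz : z ≠ 0) (hzR : ‖z‖ < R) (hx : ‖x‖ = R)
    (hG : ∀ n, |legendreG n (∑ i, unitize z i * unitize x i) 1| ≤ 1) (i : Fin 3) :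
    HasSum (fun n : ℕ => (unitize x i * legendreA (n + 1) (∑ i, unitize z i * unitize x i) 1 -
        unitize z i * legendreA n (∑ i, unitize z i * unitize x i) 1) * ‖z‖ ^ n /
          (4 * π * R ^ (n + 2)))
      (fderiv ℝ Gamma0 (x - z) (EuclideanSpace.single i 1)) := by
  have hz0 : 0 < ‖z‖ := norm_pos_iff.mpr hz
  have hR : 0 < R := hz0.trans hzR
  have hx0 : x ≠ 0 := by rintro rfl; simp at hx; exact hR.ne hx
  have hxz : x - z ≠ 0 := by
    intro h
    rw [sub_eq_zero.mp h] at hx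
    exact hzR.ne hx
  set e := unitize x with he
  set f := unitize z with hf
  set t := ∑ i, f i * e i with ht
  set ρ := ‖z‖ / R with hρ
  have hρ0 : 0 < ρ := by positivity
  have hρ1 : |ρ| < 1 := by
    rw [abs_of_pos hρ0]
    exact (div_lt_one hR).mpr hzR
  have hzρ : ‖z‖ = R * ρ := by rw [hρ]; field_simp
  have hsub : x - z = R • e - (R * ρ) • f := by
    rw [← hzρ, ← hx, he, hf, smul_unitize hx0, smul_unitize hz]
  have hnorm : ‖x - z‖ = R * √(1 - 2 * t * ρ + ρ ^ 2) := by
    rw [hsub, norm_smul_sub_smul (norm_unitize hx0) (norm_unitize hz) hR]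
  have hD := one_sub_two_mul_add_sq_pos (t := t) (hG 1) hρ1
  have hs0 := Real.sqrt_pos.mpr hD
  have s1 := hasSum_legendreA_succ hG hρ1 hρ0.ne'
  have s2 := hasSum_mul_pow_of_succ (a := fun n => legendreA n t 1) (by simp [legendreA]) s1
  have s3 := ((s1.mul_left (e i)).sub (s2.mul_left (f i))).mul_left (1 / (4 * π * R ^ 2))
  have hcoord : (x - z) i = R * (e i - ρ * f i) := by
    rw [hsub]
    simp
    ring
  have hsq := Real.sq_sqrt hD.le
  rw [fderiv_Gamma0 hxz, hnorm, hcoord]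
  convert! s3 using 1
  · funext n
    rw [hzρ]
    field_simp
    ring
  · generalize √(1 - 2 * t * ρ + ρ ^ 2) = d at hsq hs0
    rw [← hsq]
    field_simp

/-- Expansion of `∇Γ₀(x−z)` in spherical harmonics for `‖z‖ < R = ‖x‖`:
`∇Γ₀(x−z) = Σ_{n=0}^∞ Σ_{m=−n}^{n} ((n+1)Yₙᵐ(x̂)x̂ − ∇_S Yₙᵐ(x̂))/((2n+1)R^{n+2})
  · conj(Yₙᵐ(ẑ)) ‖z‖ⁿ`.
Here `Y` is any family of standard spherical harmonics: `Yₙᵐ` extends to a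
harmonic function homogeneous of degree `n`, and the family is orthonormal in
`L²(𝕊²)`. -/
theorem gradGamma0_spherical_harmonic_expansion
    (Y : ℕ → ℤ → E3 → ℂ)
    (hsmooth : ∀ (n : ℕ) (m : ℤ), m ∈ Finset.Icc (-(n : ℤ)) n →
      ContDiffOn ℝ (⊤ : ℕ∞) (fun y : E3 => Y n m (unitize y)) {x : E3 | x ≠ 0})
    (hharm : ∀ (n : ℕ) (m : ℤ), m ∈ Finset.Icc (-(n : ℤ)) n → ∀ x : E3, x ≠ 0 →
      lapC (fun y : E3 => (‖y‖ : ℂ) ^ n * Y n m (unitize y)) x = 0)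
    (horth : ∀ (n : ℕ) (m : ℤ) (n' : ℕ) (m' : ℤ), m ∈ Finset.Icc (-(n : ℤ)) n →
      m' ∈ Finset.Icc (-(n' : ℤ)) n' →
      ∫ v : Metric.sphere (0 : E3) 1,
          Y n m (v : E3) * (starRingEnd ℂ) (Y n' m' (v : E3)) ∂sphereMeasure =
        if n = n' ∧ m = m' then 1 else 0)
    (R : ℝ) (z x : E3) (hz : z ≠ 0) (hzR : ‖z‖ < R) (hx : ‖x‖ = R) (i : Fin 3) :
    HasSum
      (fun n : ℕ => ∑ m ∈ Finset.Icc (-(n : ℤ)) n,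
        ((((n : ℂ) + 1) * Y n m (unitize x) * ((unitize x) i : ℂ) -
            surfGrad (Y n m) (unitize x) i) / ((2 * (n : ℂ) + 1) * (R : ℂ) ^ (n + 2))) *
          (starRingEnd ℂ) (Y n m (unitize z)) * (‖z‖ : ℂ) ^ n)
      ((fderiv ℝ Gamma0 (x - z) (EuclideanSpace.single i 1) : ℝ) : ℂ) := by
  have hz1 : ‖unitize z‖ = 1 := norm_unitize hz
  have hR : 0 < R := (norm_nonneg z).trans_lt hzR
  have hx0 : x ≠ 0 := by rintro rfl; simp at hx; exact hR.ne hx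
  have hx1 : ‖unitize x‖ = 1 := norm_unitize hx0
  have hu0 : unitize x ≠ 0 := unitize_ne_zero hx0
  let V : ℕ → ℤ → E3 → ℂ := fun n m y => (‖y‖ : ℂ) ^ n * Y n m (unitize y)
  have hV : ∀ n : ℕ, ∀ m ∈ Finset.Icc (-(n : ℤ)) n, IsSolid n (V n m) := fun n m hm =>
    ⟨(smoothOff_norm_pow n).mul (hsmooth n m hm), IsHomog.norm_pow_mul_unitize n _, hharm n m hm⟩
  have hV1 : ∀ (n : ℕ) (m : ℤ) {y : E3}, ‖y‖ = 1 → V n m y = Y n m y := fun n m y hy => by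
    simp only [V, hy, unitize_of_norm_eq_one hy, Complex.ofReal_one, one_pow, one_mul]
  have hadd : ∀ (n : ℕ) (x y : E3), ‖x‖ = 1 → ‖y‖ = 1 →
      ∑ m ∈ Finset.Icc (-(n : ℤ)) n, (starRingEnd ℂ) (V n m x) * V n m y =
        (2 * n + 1) / (4 * π) * zonalG x n y := by
    intro n x y hx hy
    refine sum_conj_mul_eq_zonalG (hV n) (fun m hm k hk => ?_) ?_ hx hy
    · simp only [hV1 n _ (norm_sphere _)]
      simpa using horth n m n k hm hk
    · rw [Int.card_Icc]
      omega
  have hG : ∀ n, |legendreG n (∑ i, unitize z i * unitize x i) 1| ≤ 1 := fun n => by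
    simpa [zonalG_of_norm_eq_one _ n hx1] using
      norm_zonalG_le_one_of_addition (hadd n) hz1 hx1
  have hgrad : ∀ n : ℕ, ∑ m ∈ Finset.Icc (-(n : ℤ)) n,
      (starRingEnd ℂ) (V n m (unitize z)) * pdC (V n m) i (unitize x) =
        (2 * n + 1) / (4 * π) * pdC (zonalG (unitize z) n) i (unitize x) := by
    intro n
    have hs : IsSolid n fun y => ∑ m ∈ Finset.Icc (-(n : ℤ)) n,
        (starRingEnd ℂ) (V n m (unitize z)) * V n m y :=
      IsSolid.sum fun m hm => (hV n m hm).const_mul _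
    have hZ : IsSolid n fun y => ((2 * n + 1) / (4 * π) : ℂ) * zonalG (unitize z) n y :=
      (isSolid_zonalG _ (sum_mul_self_of_norm_eq_one hz1) n).const_mul _
    have heq : ∀ y : E3, y ≠ 0 → ∑ m ∈ Finset.Icc (-(n : ℤ)) n,
        (starRingEnd ℂ) (V n m (unitize z)) * V n m y =
          (2 * n + 1) / (4 * π) * zonalG (unitize z) n y := fun y hy => by
      rw [hs.homog.eq_unitize hy, hZ.homog.eq_unitize hy, hadd n _ _ hz1 (norm_unitize hy)]
    rw [← pdC_const_mul _ (smoothOff_zonalG _ n) hu0, ← pdC_congr heq hu0,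
      pdC_sum (fun m hm => ((hV n m hm).const_mul _).smooth) hu0]
    exact Finset.sum_congr rfl fun m hm => (pdC_const_mul _ (hV n m hm).smooth hu0 i).symm
  refine (Complex.hasSum_ofReal.mpr
    (hasSum_zonal_fderiv_Gamma0 hz hzR hx hG i)).congr_fun fun n => ?_
  have hn : (2 * (n : ℂ) + 1) ≠ 0 := by exact_mod_cast Nat.succ_ne_zero (2 * n)
  have hR' : (R : ℂ) ≠ 0 := by exact_mod_cast hR.ne'
  have hpi : (π : ℂ) ≠ 0 := by exact_mod_cast pi_ne_zero
  have hterm : ∀ m ∈ Finset.Icc (-(n : ℤ)) n,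
      ((((n : ℂ) + 1) * Y n m (unitize x) * ((unitize x) i : ℂ) -
        surfGrad (Y n m) (unitize x) i) / ((2 * (n : ℂ) + 1) * (R : ℂ) ^ (n + 2))) *
          (starRingEnd ℂ) (Y n m (unitize z)) * (‖z‖ : ℂ) ^ n =
      ((‖z‖ : ℂ) ^ n / ((2 * (n : ℂ) + 1) * (R : ℂ) ^ (n + 2))) *
        ((2 * n + 1) * (unitize x i : ℂ) *
          ((starRingEnd ℂ) (V n m (unitize z)) * V n m (unitize x)) -
          (starRingEnd ℂ) (V n m (unitize z)) * pdC (V n m) i (unitize x)) := by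
    intro m hm
    rw [surfGrad_eq (hsmooth n m hm) n hx1, hV1 n m hz1, hV1 n m hx1]
    ring
  have hzon := mul_zonalG_sub_pdC (unitize z) n i hx1
  rw [zonalA_of_norm_eq_one _ _ hx1, zonalA_of_norm_eq_one _ _ hx1] at hzon
  rw [Finset.sum_congr rfl hterm, ← Finset.mul_sum, Finset.sum_sub_distrib, ← Finset.mul_sum,
    hadd n _ _ hz1 hx1, hgrad]
  push_cast
  field_simp
  linear_combination (‖z‖ : ℂ) ^ n * hzon
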